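/- arXiv:1204.4877 — 2 statements merged into one kernel-verified Lean document; each statement's English description precedes it below -/
import Mathlib

section
/- Let n ≥ 2 be an integer and let ν be a Lévy measure on ℝ with ν(ℝ) = +∞ and ∫ |y|^k ν(dy) < ∞ for k = 2, …, n; set m_k = ∫ y^k ν(dy) for 2 ≤ k ≤ n−1. Let Λ > 0 be such that there exists at least one finite positive measure ν̄ on ℝ with ν̄(ℝ) = Λ and ∫ y^k ν̄(dy) = m_k for k = 2, …, n−1. Then the problem Ω_{n,Λ} admits a solution: there exists a finite positive measure ν̄* satisfying these constraints with J(ν̄*) = inf { J(ν̄) : ν̄ a finite positive measure, ν̄(ℝ) = Λ, ∫ y^k ν̄(dy) = m_k for k = 2, …, n−1 }. -/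
open MeasureTheory Filter Set
open scoped ENNReal

/-- The total variation measure `|μ - ν| = (μ - μ⊓ν) + (ν - μ⊓ν)` of the difference of two
positive measures. -/
noncomputable def tvDist (μ ν : Measure ℝ) : Measure ℝ := (μ - μ ⊓ ν) + (ν - μ ⊓ ν)

/-- The functional `J(ν̄) = ∫ |y|^n |ν - ν̄|(dy)`. -/
noncomputable def Jfun (n : ℕ) (ν νb : Measure ℝ) : ℝ≥0∞ :=
  ∫⁻ y, ENNReal.ofReal (|y| ^ n) ∂(tvDist ν νb)

/-- The constraint set of problem `Ω_{n,Λ}`: finite positive measures of total mass `Λ` whose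
moments of orders `2,…,n-1` coincide with those of `ν`. -/
def Constraint (n : ℕ) (ν : Measure ℝ) (Λ : ℝ) (νb : Measure ℝ) : Prop :=
  IsFiniteMeasure νb ∧ νb Set.univ = ENNReal.ofReal Λ ∧
    ∀ k, 2 ≤ k → k ≤ n - 1 →
      MeasureTheory.Integrable (fun y => y ^ k) νb ∧ (∫ y, y ^ k ∂νb) = ∫ y, y ^ k ∂ν

open scoped Topology NNReal BoundedContinuousFunction

/-- A finite Borel measure `μ` is dominated by a finite Borel measure `ν` as soon as this holds
after integrating nonnegative bounded continuous functions. -/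
theorem measure_le_of_forall_lintegral_le {Ω : Type*} [MeasurableSpace Ω] [TopologicalSpace Ω]
    [TopologicalSpace.PseudoMetrizableSpace Ω] [BorelSpace Ω] {μ ν : Measure Ω}
    [IsFiniteMeasure μ] [IsFiniteMeasure ν]
    (h : ∀ f : Ω →ᵇ ℝ≥0, ∫⁻ x, f x ∂μ ≤ ∫⁻ x, f x ∂ν) : μ ≤ ν := by
  refine Measure.le_iff.2 fun s hs => ?_
  rw [hs.measure_eq_iSup_isClosed_of_ne_top (measure_ne_top μ s)]
  refine iSup_le fun F => iSup_le fun hFs => iSup_le fun hF => ?_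
  exact (le_of_tendsto_of_tendsto' (HasOuterApproxClosed.tendsto_lintegral_apprSeq hF μ)
    (HasOuterApproxClosed.tendsto_lintegral_apprSeq hF ν) fun i => h _).trans (measure_mono hFs)

/-- The bounded continuous truncation `y ↦ min (|y|^n) R`. -/
noncomputable def truncPow (n : ℕ) (R : ℝ≥0) : ℝ →ᵇ ℝ≥0 :=
  BoundedContinuousFunction.mkOfBound ⟨fun y => min (‖y‖₊ ^ n) R, by fun_prop⟩ R (fun x y => by
    rw [NNReal.dist_eq, abs_le]
    have h1 : ((min (‖x‖₊ ^ n) R : ℝ≥0) : ℝ) ≤ R := NNReal.coe_le_coe.2 (min_le_right _ _)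
    have h2 : ((min (‖y‖₊ ^ n) R : ℝ≥0) : ℝ) ≤ R := NNReal.coe_le_coe.2 (min_le_right _ _)
    have h3 := (min (‖x‖₊ ^ n) R).coe_nonneg
    have h4 := (min (‖y‖₊ ^ n) R).coe_nonneg
    constructor <;> simp only [ContinuousMap.coe_mk] <;> linarith)

theorem ofReal_abs_pow (n : ℕ) (y : ℝ) : ENNReal.ofReal (|y| ^ n) = ((‖y‖₊ ^ n : ℝ≥0) : ℝ≥0∞) := by
  rw [← Real.norm_eq_abs, ← coe_nnnorm, ← NNReal.coe_pow, ENNReal.ofReal_coe_nnreal]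

theorem coe_truncPow (n : ℕ) (R : ℝ≥0) (y : ℝ) :
    (truncPow n R y : ℝ≥0∞) = min (ENNReal.ofReal (|y| ^ n)) R := by
  rw [ofReal_abs_pow, ← ENNReal.coe_min]; rfl

theorem truncPow_le (n : ℕ) (R : ℝ≥0) (y : ℝ) :
    (truncPow n R y : ℝ≥0∞) ≤ ENNReal.ofReal (|y| ^ n) := by
  rw [coe_truncPow]; exact min_le_left _ _

theorem measurable_ofReal_abs_pow (n : ℕ) : Measurable fun y : ℝ => ENNReal.ofReal (|y| ^ n) := by
  fun_prop

theorem measurable_truncPow (n : ℕ) (R : ℝ≥0) : Measurable fun y => (truncPow n R y : ℝ≥0∞) :=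
  (truncPow n R).continuous.measurable.coe_nnreal_ennreal

theorem eventually_truncPow_eq (n : ℕ) (y : ℝ) :
    ∀ᶠ R : ℕ in atTop, (truncPow n R y : ℝ≥0∞) = ENNReal.ofReal (|y| ^ n) := by
  obtain ⟨N, hN⟩ := exists_nat_ge (‖y‖₊ ^ n)
  filter_upwards [eventually_ge_atTop N] with R hR
  rw [coe_truncPow, min_eq_left]
  rw [ofReal_abs_pow]
  exact ENNReal.coe_le_coe.2 (hN.trans (by exact_mod_cast hR))

theorem tendsto_lintegral_truncPow (n : ℕ) (μ : Measure ℝ) :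
    Tendsto (fun R : ℕ => ∫⁻ y, truncPow n R y ∂μ) atTop
      (𝓝 (∫⁻ y, ENNReal.ofReal (|y| ^ n) ∂μ)) := by
  refine lintegral_tendsto_of_tendsto_of_monotone (fun R => (measurable_truncPow n R).aemeasurable)
    (ae_of_all _ fun y R S hRS => ?_)
    (ae_of_all _ fun y => tendsto_const_nhds.congr' ?_)
  · simp only [coe_truncPow]
    gcongr
  · filter_upwards [eventually_truncPow_eq n y] with R hR using hR.symm

theorem tendsto_lintegral_tsub_truncPow (n : ℕ) (μ : Measure ℝ)
    (hμ : ∫⁻ y, ENNReal.ofReal (|y| ^ n) ∂μ ≠ ⊤) :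
    Tendsto (fun R : ℕ => ∫⁻ y, (ENNReal.ofReal (|y| ^ n) - truncPow n R y) ∂μ) atTop (𝓝 0) := by
  have := tendsto_lintegral_of_dominated_convergence (μ := μ)
    (F := fun (R : ℕ) y => ENNReal.ofReal (|y| ^ n) - truncPow n R y) (f := fun _ => 0)
    (fun y => ENNReal.ofReal (|y| ^ n))
    (fun R => (measurable_ofReal_abs_pow n).sub (measurable_truncPow n R))
    (fun R => ae_of_all _ fun y => tsub_le_self) hμ
    (ae_of_all _ fun y => tendsto_const_nhds.congr' ?_)
  · simpa using this
  · filter_upwards [eventually_truncPow_eq n y] with R hR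
    rw [hR, tsub_self]

/-- The moment of order `n` is lower semicontinuous along weak convergence. -/
theorem lintegral_abs_pow_le_of_tendsto {ι : Type*} {L : Filter ι} [L.NeBot]
    {μs : ι → FiniteMeasure ℝ} {μ : FiniteMeasure ℝ} (hμ : Tendsto μs L (𝓝 μ)) (n : ℕ) {M : ℝ≥0∞}
    (hM : ∀ i, ∫⁻ y, ENNReal.ofReal (|y| ^ n) ∂(μs i : Measure ℝ) ≤ M) :
    ∫⁻ y, ENNReal.ofReal (|y| ^ n) ∂(μ : Measure ℝ) ≤ M :=
  le_of_tendsto' (tendsto_lintegral_truncPow n _) fun R =>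
    le_of_tendsto' (FiniteMeasure.tendsto_iff_forall_lintegral_tendsto.1 hμ (truncPow n R))
      fun i => (lintegral_mono fun y => truncPow_le n R y).trans (hM i)

/-- A weak limit of finite measures dominated by `ν` is dominated by `ν` away from the origin,
provided `ν` has a finite moment and does not charge the origin. -/
theorem restrict_compl_zero_le_of_tendsto {ι : Type*} {L : Filter ι} [L.NeBot]
    {θs : ι → FiniteMeasure ℝ} {θ : FiniteMeasure ℝ} (hθ : Tendsto θs L (𝓝 θ)) {ν : Measure ℝ}
    (hle : ∀ i, (θs i : Measure ℝ) ≤ ν) (hν0 : ν {0} = 0) (n : ℕ)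
    (hν : ∫⁻ y, ENNReal.ofReal (|y| ^ n) ∂ν ≠ ⊤) :
    (θ : Measure ℝ).restrict {0}ᶜ ≤ ν := by
  set w : ℝ → ℝ≥0∞ := fun y => truncPow n 1 y with hw
  have hwm : Measurable w := measurable_truncPow n 1
  have hw0 : ∀ y, y ≠ 0 → w y ≠ 0 := fun y hy => by
    simp only [hw, coe_truncPow]
    simp [hy]
  have hwtop : ∀ y, w y ≠ ⊤ := fun y => ENNReal.coe_ne_top
  have hθ0 : (θ : Measure ℝ).restrict {0}ᶜ ≤ θ := Measure.restrict_le_self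
  have : IsFiniteMeasure (ν.withDensity w) := isFiniteMeasure_withDensity
    ((lintegral_mono fun y => truncPow_le n 1 y).trans_lt hν.lt_top).ne
  have : IsFiniteMeasure (((θ : Measure ℝ).restrict {0}ᶜ).withDensity w) := by
    refine isFiniteMeasure_withDensity (ne_top_of_le_ne_top ?_
      (lintegral_mono (g := fun _ => 1) fun y => ?_))
    · simp
    · simp only [hw, coe_truncPow]
      exact min_le_right _ _
  have key : ((θ : Measure ℝ).restrict {0}ᶜ).withDensity w ≤ ν.withDensity w := by
    refine measure_le_of_forall_lintegral_le fun f => ?_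
    have hf : Measurable fun y => (f y : ℝ≥0∞) := f.continuous.measurable.coe_nnreal_ennreal
    rw [lintegral_withDensity_eq_lintegral_mul _ hwm hf,
      lintegral_withDensity_eq_lintegral_mul _ hwm hf]
    refine (lintegral_mono' hθ0 le_rfl).trans ?_
    have hlim := FiniteMeasure.tendsto_iff_forall_lintegral_tendsto.1 hθ (truncPow n 1 * f)
    simp only [BoundedContinuousFunction.coe_mul, Pi.mul_apply, ENNReal.coe_mul] at hlim
    exact le_of_tendsto' hlim fun i => lintegral_mono' (hle i) le_rfl
  have hν' : ∀ᵐ y ∂ν, w y ≠ 0 := by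
    have : ∀ᵐ y ∂ν, y ≠ 0 := by
      rw [ae_iff]; simpa using hν0
    filter_upwards [this] with y hy using hw0 y hy
  have hθ' : ∀ᵐ y ∂(θ : Measure ℝ).restrict {0}ᶜ, w y ≠ 0 := by
    filter_upwards [ae_restrict_mem (measurableSet_singleton (0 : ℝ)).compl] with y hy
      using hw0 y hy
  rw [← withDensity_inv_same hwm hν' (ae_of_all _ hwtop),
    ← withDensity_inv_same hwm hθ' (ae_of_all _ hwtop)]
  refine Measure.le_iff.2 fun s hs => ?_
  rw [withDensity_apply _ hs, withDensity_apply _ hs]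
  exact lintegral_mono' (Measure.restrict_mono le_rfl key) le_rfl

/-- Finite measures on `ℝ` with bounded mass and bounded moment of positive order are relatively
compact. -/
theorem exists_tendsto_of_lintegral_abs_pow_le {ι : Type*} (U : Ultrafilter ι)
    (μs : ι → FiniteMeasure ℝ) {C M : ℝ≥0} {n : ℕ} (hn : n ≠ 0) (hC : ∀ i, (μs i).mass ≤ C)
    (hM : ∀ i, ∫⁻ y, ENNReal.ofReal (|y| ^ n) ∂(μs i : Measure ℝ) ≤ M) :
    ∃ μ : FiniteMeasure ℝ, Tendsto μs U (𝓝 μ) := by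
  have hu : Tendsto (fun j : ℕ => M / ((j : ℝ≥0) + 1)) atTop (𝓝 0) := by
    rw [← NNReal.tendsto_coe]
    push_cast
    simpa [div_eq_mul_inv] using (tendsto_one_div_add_atTop_nhds_zero_nat (𝕜 := ℝ)).const_mul (M : ℝ)
  have hK := isCompact_setOfPred_finiteMeasure_mass_le_compl_isCompact_le (E := ℝ) C hu
    (K := fun j : ℕ => Metric.closedBall 0 ((j : ℝ) + 1)) (fun j => isCompact_closedBall _ _)
    (Or.inl inferInstance)
  have hmem : ∀ i (j : ℕ), μs i (Metric.closedBall 0 ((j : ℝ) + 1))ᶜ ≤ M / ((j : ℝ≥0) + 1) := by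
    intro i j
    rw [le_div_iff₀ (by positivity), ← ENNReal.coe_le_coe, ENNReal.coe_mul,
      FiniteMeasure.ennreal_coeFn_eq_coeFn_toMeasure, mul_comm]
    refine le_trans ?_ (hM i)
    refine le_trans ?_ (mul_meas_ge_le_lintegral (measurable_ofReal_abs_pow n)
      (((j : ℝ≥0) + 1 : ℝ≥0) : ℝ≥0∞))
    gcongr
    intro y hy
    have hy' : (j : ℝ) + 1 < |y| := by simpa using hy
    rw [Set.mem_ofPred_eq, ofReal_abs_pow, ENNReal.coe_le_coe, ← NNReal.coe_le_coe]
    push_cast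
    rw [Real.norm_eq_abs]
    exact hy'.le.trans (le_self_pow₀ (by linarith [(Nat.cast_nonneg j : (0 : ℝ) ≤ j)]) hn)
  obtain ⟨μ, -, hμ⟩ := hK.ultrafilter_le_nhds' (U.map μs)
    (Ultrafilter.mem_map.2 (Filter.univ_mem' fun i => ⟨hC i, hmem i⟩))
  exact ⟨μ, hμ⟩

theorem integrable_pow_of_lintegral_abs_pow_ne_top {μ : Measure ℝ} [IsFiniteMeasure μ] {n k : ℕ}
    (hkn : k ≤ n) (hμ : ∫⁻ y, ENNReal.ofReal (|y| ^ n) ∂μ ≠ ⊤) :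
    Integrable (fun y : ℝ => y ^ k) μ := by
  have hn : Integrable (fun y : ℝ => |y| ^ n) μ :=
    ⟨by fun_prop, (hasFiniteIntegral_iff_ofReal (ae_of_all _ fun y => by positivity)).2 hμ.lt_top⟩
  refine ((integrable_const (1 : ℝ)).add hn).mono' (by fun_prop) (ae_of_all _ fun y => ?_)
  rw [norm_pow, Real.norm_eq_abs, Pi.add_apply]
  rcases le_total |y| 1 with h | h
  · have h1 : |y| ^ k ≤ 1 := pow_le_one₀ (abs_nonneg y) h
    have h2 : 0 ≤ |y| ^ n := by positivity
    linarith
  · have := pow_le_pow_right₀ h hkn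
    linarith

/-- The bounded continuous function `y ↦ c(y)^k`, where `c` clips `y` to `[-R, R]`. -/
noncomputable def clipPow (k : ℕ) (R : ℝ) : ℝ →ᵇ ℝ :=
  BoundedContinuousFunction.ofNormedAddCommGroup (fun y => max (-|R|) (min |R| y) ^ k)
    (by fun_prop) (|R| ^ k) fun y => by
      rw [norm_pow, Real.norm_eq_abs]
      exact pow_le_pow_left₀ (abs_nonneg _)
        (abs_le.2 ⟨le_max_left _ _, max_le (neg_le_self (abs_nonneg R)) (min_le_left _ _)⟩) k

theorem abs_pow_sub_clipPow_le {k n : ℕ} (hkn : k < n) {R : ℝ} (hR : 1 ≤ R) (y : ℝ) :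
    |y ^ k - clipPow k R y| ≤ 2 * |y| ^ n / R := by
  have hR0 : 0 < R := by linarith
  have hc : clipPow k R y = max (-R) (min R y) ^ k := by
    simp [clipPow, abs_of_pos hR0]
  rw [hc]
  rcases le_total |y| R with h | h
  · rw [min_eq_right (abs_le.1 h).2, max_eq_right (abs_le.1 h).1, sub_self, abs_zero]
    positivity
  · have hclip : |max (-R) (min R y)| ≤ |y| :=
      (abs_le.2 ⟨le_max_left _ _, max_le (by linarith) (min_le_left _ _)⟩).trans h
    have h1 : |max (-R) (min R y) ^ k| ≤ |y| ^ k := by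
      rw [abs_pow]; gcongr
    have h2 : |y| ^ k * R ≤ |y| ^ n :=
      calc |y| ^ k * R ≤ |y| ^ k * |y| := by gcongr
        _ = |y| ^ (k + 1) := (pow_succ _ _).symm
        _ ≤ |y| ^ n := pow_le_pow_right₀ (hR.trans h) hkn
    rw [le_div_iff₀ hR0]
    have h3 : |y ^ k - max (-R) (min R y) ^ k| ≤ 2 * |y| ^ k :=
      (abs_sub _ _).trans (by rw [abs_pow y]; linarith)
    nlinarith

theorem abs_integral_pow_sub_integral_clipPow_le {μ : Measure ℝ} [IsFiniteMeasure μ] {n k : ℕ}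
    (hkn : k < n) {M : ℝ≥0} (hM : ∫⁻ y, ENNReal.ofReal (|y| ^ n) ∂μ ≤ M) {R : ℝ} (hR : 1 ≤ R) :
    |∫ y, y ^ k ∂μ - ∫ y, clipPow k R y ∂μ| ≤ 2 * M / R := by
  have hne : ∫⁻ y, ENNReal.ofReal (|y| ^ n) ∂μ ≠ ⊤ := ne_top_of_le_ne_top ENNReal.coe_ne_top hM
  have hR0 : 0 < R := by linarith
  have hn : Integrable (fun y : ℝ => |y| ^ n) μ :=
    ⟨by fun_prop, (hasFiniteIntegral_iff_ofReal (ae_of_all _ fun y => by positivity)).2 hne.lt_top⟩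
  have hnM : ∫ y, |y| ^ n ∂μ ≤ M := by
    rw [integral_eq_lintegral_of_nonneg_ae (ae_of_all _ fun y => by positivity) (by fun_prop)]
    exact ENNReal.toReal_mono ENNReal.coe_ne_top hM
  rw [← integral_sub (integrable_pow_of_lintegral_abs_pow_ne_top hkn.le hne)
    ((clipPow k R).integrable μ)]
  calc |∫ y, (y ^ k - clipPow k R y) ∂μ| ≤ ∫ y, 2 * |y| ^ n / R ∂μ :=
        norm_integral_le_of_norm_le (f := fun y => y ^ k - clipPow k R y)
          ((hn.const_mul 2).div_const R) (ae_of_all _ fun y => abs_pow_sub_clipPow_le hkn hR y)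
    _ = 2 * (∫ y, |y| ^ n ∂μ) / R := by rw [integral_div, integral_const_mul]
    _ ≤ 2 * M / R := by gcongr

/-- A moment constraint of order `k` passes to weak limits when the moments of some larger order
`n` are bounded. -/
theorem integral_pow_eq_of_tendsto {ι : Type*} {L : Filter ι} [L.NeBot]
    {μs : ι → FiniteMeasure ℝ} {μ : FiniteMeasure ℝ} (hμ : Tendsto μs L (𝓝 μ)) {n k : ℕ}
    (hkn : k < n) {M : ℝ≥0}
    (hM : ∀ i, ∫⁻ y, ENNReal.ofReal (|y| ^ n) ∂(μs i : Measure ℝ) ≤ M) {m : ℝ}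
    (hm : ∀ i, ∫ y, y ^ k ∂(μs i : Measure ℝ) = m) :
    ∫ y, y ^ k ∂(μ : Measure ℝ) = m := by
  have hbound : ∀ j : ℕ, |∫ y, y ^ k ∂(μ : Measure ℝ) - m| ≤ (4 * M) * (1 / ((j : ℝ) + 1)) := by
    intro j
    set R : ℝ := (j : ℝ) + 1
    have hR : 1 ≤ R := by simp [R]
    have hlim : Tendsto (fun i => |m - ∫ y, clipPow k R y ∂(μs i : Measure ℝ)|) L
        (𝓝 |m - ∫ y, clipPow k R y ∂(μ : Measure ℝ)|) :=
      (tendsto_const_nhds.sub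
        (FiniteMeasure.tendsto_iff_forall_integral_tendsto.1 hμ (clipPow k R))).abs
    have h1 : |m - ∫ y, clipPow k R y ∂(μ : Measure ℝ)| ≤ 2 * M / R :=
      le_of_tendsto' hlim fun i => by
        rw [← hm i]
        exact abs_integral_pow_sub_integral_clipPow_le hkn (hM i) hR
    have h2 := abs_integral_pow_sub_integral_clipPow_le hkn
      (lintegral_abs_pow_le_of_tendsto hμ n hM) hR
    have h3 := abs_sub_le (∫ y, y ^ k ∂(μ : Measure ℝ)) (∫ y, clipPow k R y ∂(μ : Measure ℝ)) m
    rw [abs_sub_comm (∫ y, clipPow k R y ∂(μ : Measure ℝ)) m] at h3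
    have h4 : (4 * M : ℝ) * (1 / R) = 2 * M / R + 2 * M / R := by ring
    linarith
  have hlim := (tendsto_one_div_add_atTop_nhds_zero_nat (𝕜 := ℝ)).const_mul (4 * M : ℝ)
  rw [mul_zero] at hlim
  exact sub_eq_zero.1 (abs_nonpos_iff.1 (ge_of_tendsto' hlim hbound))

/-- A common lower bound `θ` of `ν` and `θ + ρ` bounds the functional from above. -/
theorem Jfun_add_lintegral_le (n : ℕ) {ν θ ρ : Measure ℝ} [IsFiniteMeasure θ] (hθ : θ ≤ ν) :
    Jfun n ν (θ + ρ) + ∫⁻ y, ENNReal.ofReal (|y| ^ n) ∂θ ≤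
      ∫⁻ y, ENNReal.ofReal (|y| ^ n) ∂ν + ∫⁻ y, ENNReal.ofReal (|y| ^ n) ∂ρ := by
  have hinf : θ ≤ ν ⊓ (θ + ρ) := le_inf hθ (Measure.le_add_right le_rfl)
  have h1 : ν - ν ⊓ (θ + ρ) ≤ ν - θ := by
    refine Measure.sub_le_of_le_add ?_
    calc ν = ν - θ + θ := (Measure.sub_add_cancel_of_le hθ).symm
      _ ≤ _ := by gcongr
  have h2 : θ + ρ - ν ⊓ (θ + ρ) ≤ ρ := by
    refine Measure.sub_le_of_le_add ?_
    calc θ + ρ = ρ + θ := add_comm _ _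
      _ ≤ ρ + ν ⊓ (θ + ρ) := by gcongr
  have h3 : tvDist ν (θ + ρ) ≤ (ν - θ) + ρ := add_le_add h1 h2
  calc _ ≤ ∫⁻ y, ENNReal.ofReal (|y| ^ n) ∂(ν - θ + ρ) + ∫⁻ y, ENNReal.ofReal (|y| ^ n) ∂θ := by
        unfold Jfun
        gcongr
    _ = ∫⁻ y, ENNReal.ofReal (|y| ^ n) ∂(ν - θ + θ) + ∫⁻ y, ENNReal.ofReal (|y| ^ n) ∂ρ := by
        simp only [lintegral_add_measure]; ring
    _ = _ := by rw [Measure.sub_add_cancel_of_le hθ]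

theorem Jfun_add_lintegral_inf (n : ℕ) (ν νb : Measure ℝ) [IsFiniteMeasure νb] :
    Jfun n ν νb + ∫⁻ y, ENNReal.ofReal (|y| ^ n) ∂(ν ⊓ νb) =
      ∫⁻ y, ENNReal.ofReal (|y| ^ n) ∂ν + ∫⁻ y, ENNReal.ofReal (|y| ^ n) ∂(νb - ν ⊓ νb) := by
  have : IsFiniteMeasure (ν ⊓ νb) := isFiniteMeasure_of_le νb inf_le_right
  have h : ν - ν ⊓ νb + ν ⊓ νb = ν := Measure.sub_add_cancel_of_le inf_le_left
  have h' : ∫⁻ y, ENNReal.ofReal (|y| ^ n) ∂ν =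
      ∫⁻ y, ENNReal.ofReal (|y| ^ n) ∂(ν - ν ⊓ νb + ν ⊓ νb) := by rw [h]
  rw [h', Jfun, tvDist, lintegral_add_measure, lintegral_add_measure]
  ring

theorem lintegral_sub_inf_le_of_Jfun_le {n : ℕ} {ν νb : Measure ℝ} {c : ℝ≥0∞}
    (h : Jfun n ν νb ≤ c) : ∫⁻ y, ENNReal.ofReal (|y| ^ n) ∂(νb - ν ⊓ νb) ≤ c := by
  refine le_trans ?_ h
  rw [Jfun, tvDist, lintegral_add_measure]
  exact le_add_self

/-- Proposition `PropExistSolution`: the problem `Ω_{n,Λ}` admits a solution. -/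
theorem stmt_3 (n : ℕ) (hn : 2 ≤ n) (ν : Measure ℝ)
    (hν0 : ν {0} = 0) (hνinf : ν Set.univ = ⊤)
    (hmom : ∀ k, 2 ≤ k → k ≤ n → (∫⁻ y, ENNReal.ofReal (|y| ^ k) ∂ν) < ⊤)
    (Λ : ℝ) (hΛ : 0 < Λ)
    (hfeas : ∃ νb : Measure ℝ, Constraint n ν Λ νb) :
    ∃ νstar : Measure ℝ, Constraint n ν Λ νstar ∧
      Jfun n ν νstar = ⨅ (νb : Measure ℝ) (_ : Constraint n ν Λ νb), Jfun n ν νb := by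
  set I : ℝ≥0∞ := ⨅ (νb : Measure ℝ) (_ : Constraint n ν Λ νb), Jfun n ν νb with hI
  have hIle : ∀ νb, Constraint n ν Λ νb → I ≤ Jfun n ν νb := fun νb h => iInf₂_le νb h
  suffices h : ∃ νstar, Constraint n ν Λ νstar ∧ Jfun n ν νstar ≤ I by
    obtain ⟨νstar, hc, hle⟩ := h
    exact ⟨νstar, hc, le_antisymm hle (hIle _ hc)⟩
  by_cases hItop : I = ⊤
  · obtain ⟨νb, hνb⟩ := hfeas
    exact ⟨νb, hνb, hItop ▸ le_top⟩
  have hV := (hmom n hn le_rfl).ne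
  set φ : ℝ → ℝ≥0∞ := fun y => ENNReal.ofReal (|y| ^ n) with hφ
  -- a minimizing sequence, split into its part below `ν` and the remainder
  have hseq : ∀ j : ℕ, ∃ νb, Constraint n ν Λ νb ∧ Jfun n ν νb ≤ I + ((j : ℝ≥0∞) + 1)⁻¹ := by
    intro j
    have hlt : I < I + ((j : ℝ≥0∞) + 1)⁻¹ := ENNReal.lt_add_right hItop (by simp)
    obtain ⟨νb, h⟩ := iInf_lt_iff.1 (hI ▸ hlt)
    obtain ⟨hc, h⟩ := iInf_lt_iff.1 h
    exact ⟨νb, hc, h.le⟩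
  choose νs hνs hJ using hseq
  have hfin : ∀ j, IsFiniteMeasure (νs j) := fun j => (hνs j).1
  have hθfin : ∀ j, IsFiniteMeasure (ν ⊓ νs j) := fun j => isFiniteMeasure_of_le _ inf_le_right
  have hρfin : ∀ j, IsFiniteMeasure (νs j - ν ⊓ νs j) := fun j =>
    isFiniteMeasure_of_le _ Measure.sub_le
  let μs : ℕ → FiniteMeasure ℝ := fun j => ⟨νs j, hfin j⟩
  let θs : ℕ → FiniteMeasure ℝ := fun j => ⟨ν ⊓ νs j, hθfin j⟩
  let ρs : ℕ → FiniteMeasure ℝ := fun j => ⟨νs j - ν ⊓ νs j, hρfin j⟩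
  have hsum : ∀ j, θs j + ρs j = μs j := fun j => by
    apply Subtype.ext
    exact (add_comm _ _).trans (Measure.sub_add_cancel_of_le inf_le_right)
  -- bounds on masses and moments
  have hJ1 : ∀ j, Jfun n ν (νs j) ≤ I + 1 := fun j => (hJ j).trans (by
    gcongr
    exact ENNReal.inv_le_one.2 le_add_self)
  obtain ⟨M, hM⟩ : ∃ M : ℝ≥0, (M : ℝ≥0∞) = ∫⁻ y, φ y ∂ν + (I + 1) :=
    ⟨_, ENNReal.coe_toNNReal (ENNReal.add_ne_top.2 ⟨hV, by simp [hItop]⟩)⟩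
  have hmass : ∀ j, (μs j : Measure ℝ) univ = ENNReal.ofReal Λ := fun j => (hνs j).2.1
  have hθM : ∀ j, ∫⁻ y, φ y ∂(θs j : Measure ℝ) ≤ ∫⁻ y, φ y ∂ν := fun j =>
    lintegral_mono' inf_le_left le_rfl
  have hρM : ∀ j, ∫⁻ y, φ y ∂(ρs j : Measure ℝ) ≤ I + 1 := fun j =>
    lintegral_sub_inf_le_of_Jfun_le (hJ1 j)
  have hμM : ∀ j, ∫⁻ y, φ y ∂(μs j : Measure ℝ) ≤ M := fun j => by
    rw [← hsum j, FiniteMeasure.toMeasure_add, lintegral_add_measure, hM]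
    exact add_le_add (hθM j) (hρM j)
  have hmassle : ∀ (σ : FiniteMeasure ℝ) (j : ℕ), (σ : Measure ℝ) ≤ μs j →
      σ.mass ≤ Λ.toNNReal := fun σ j h => by
    rw [← ENNReal.coe_le_coe, FiniteMeasure.ennreal_mass]
    exact (h univ).trans (hmass j).le
  -- extraction of limits along an ultrafilter
  set U : Ultrafilter ℕ := hyperfilter ℕ
  have hU : (U : Filter ℕ) ≤ atTop := Nat.hyperfilter_le_atTop
  obtain ⟨θ, hθ⟩ := exists_tendsto_of_lintegral_abs_pow_le U θs (n := n) (by lia)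
    (fun j => hmassle _ j inf_le_right)
    (fun j => (hθM j).trans (le_self_add.trans hM.ge))
  obtain ⟨ρ, hρ⟩ := exists_tendsto_of_lintegral_abs_pow_le U ρs (n := n) (by lia)
    (fun j => hmassle _ j Measure.sub_le)
    (fun j => (hρM j).trans (le_add_self.trans hM.ge))
  have hμ : Tendsto μs U (𝓝 (θ + ρ)) := (hθ.add hρ).congr hsum
  have hθle : (θ : Measure ℝ).restrict {0}ᶜ ≤ ν :=
    restrict_compl_zero_le_of_tendsto hθ (fun j => inf_le_left) hν0 n hV
  have hstarM := lintegral_abs_pow_le_of_tendsto hμ n hμM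
  refine ⟨(θ + ρ : FiniteMeasure ℝ), ⟨inferInstance, ?_, fun k hk2 hk => ⟨?_, ?_⟩⟩, ?_⟩
  · have h := (FiniteMeasure.continuous_mass.tendsto (θ + ρ)).comp hμ
    have hΛ' : ∀ j, (μs j).mass = Λ.toNNReal := fun j => by
      rw [← ENNReal.coe_inj, FiniteMeasure.ennreal_mass]
      exact hmass j
    have heq := tendsto_nhds_unique h (tendsto_const_nhds.congr fun j => (hΛ' j).symm)
    rw [← FiniteMeasure.ennreal_mass, heq]
    rfl
  · exact integrable_pow_of_lintegral_abs_pow_ne_top (n := n) (by lia)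
      (ne_top_of_le_ne_top ENNReal.coe_ne_top hstarM)
  · exact integral_pow_eq_of_tendsto hμ (n := n) (by lia) hμM fun j => ((hνs j).2.2 k hk2 hk).2
  -- passing to the limit in the functional, first with truncated integrands
  have htrunc : ∀ R : ℕ, ∫⁻ y, φ y ∂ν + ∫⁻ y, truncPow n R y ∂(ρ : Measure ℝ) ≤
      I + (∫⁻ y, truncPow n R y ∂(θ : Measure ℝ) + ∫⁻ y, (φ y - truncPow n R y) ∂ν) := by
    intro R
    have hinv : Tendsto (fun j : ℕ => I + ((j : ℝ≥0∞) + 1)⁻¹) U (𝓝 I) := by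
      have h := (ENNReal.tendsto_inv_nat_nhds_zero.comp (tendsto_add_atTop_nat 1)).mono_left hU
      simpa [Function.comp_def] using h.const_add I
    have hρR := FiniteMeasure.tendsto_iff_forall_lintegral_tendsto.1 hρ (truncPow n R)
    have hθR := FiniteMeasure.tendsto_iff_forall_lintegral_tendsto.1 hθ (truncPow n R)
    refine le_of_tendsto_of_tendsto' (hρR.const_add _)
      (hinv.add (hθR.add tendsto_const_nhds)) fun j => ?_
    calc ∫⁻ y, φ y ∂ν + ∫⁻ y, truncPow n R y ∂(ρs j : Measure ℝ)
        ≤ ∫⁻ y, φ y ∂ν + ∫⁻ y, φ y ∂(ρs j : Measure ℝ) := by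
          gcongr with y
          exact truncPow_le n R y
      _ = Jfun n ν (νs j) + ∫⁻ y, φ y ∂(θs j : Measure ℝ) := (Jfun_add_lintegral_inf n ν _).symm
      _ = Jfun n ν (νs j) + (∫⁻ y, truncPow n R y ∂(θs j : Measure ℝ) +
            ∫⁻ y, (φ y - truncPow n R y) ∂(θs j : Measure ℝ)) := by
          rw [← lintegral_add_left (measurable_truncPow n R)]
          simp_rw [hφ, add_tsub_cancel_of_le (truncPow_le n R _)]
      _ ≤ _ := by
          gcongr
          · exact hJ j
          · exact inf_le_left
  have hmain : ∫⁻ y, φ y ∂ν + ∫⁻ y, φ y ∂(ρ : Measure ℝ) ≤ I + ∫⁻ y, φ y ∂(θ : Measure ℝ) := by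
    have h := le_of_tendsto_of_tendsto' ((tendsto_lintegral_truncPow n (ρ : Measure ℝ)).const_add _)
      (((tendsto_lintegral_truncPow n (θ : Measure ℝ)).add
        (tendsto_lintegral_tsub_truncPow n ν hV)).const_add I) htrunc
    rwa [add_zero] at h
  have hsplit : (θ : Measure ℝ).restrict {0}ᶜ + ((θ : Measure ℝ).restrict {0} + ρ) =
      ((θ + ρ : FiniteMeasure ℝ) : Measure ℝ) := by
    rw [← add_assoc, Measure.restrict_compl_add_restrict (measurableSet_singleton _)]
    rfl
  have hzero : ∫⁻ y, φ y ∂(θ : Measure ℝ).restrict {0} = 0 := by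
    rw [Measure.restrict_singleton, lintegral_smul_measure, lintegral_dirac]
    have : n ≠ 0 := by lia
    simp [hφ, this]
  have hθsplit : ∫⁻ y, φ y ∂(θ : Measure ℝ).restrict {0}ᶜ = ∫⁻ y, φ y ∂(θ : Measure ℝ) := by
    rw [← lintegral_add_compl (μ := θ) φ (measurableSet_singleton (0 : ℝ)), hzero, zero_add]
  have hstar := Jfun_add_lintegral_le n (ρ := (θ : Measure ℝ).restrict {0} + ρ) hθle
  rw [hsplit, lintegral_add_measure, hzero, zero_add, hθsplit] at hstar
  have hθtop : ∫⁻ y, φ y ∂(θ : Measure ℝ) ≠ ⊤ :=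
    ne_top_of_le_ne_top hV (lintegral_abs_pow_le_of_tendsto hθ n hθM)
  exact (ENNReal.add_le_add_iff_right hθtop).1 (hstar.trans hmain)
end

section
/- Let n ≥ 2 be an even integer and let ν be a Lévy measure on ℝ with ν(ℝ) = ∞ and ∫ |y|^k ν(dy) < ∞ for k = 2, …, n, satisfying assumption (R_α) for some α ∈ (0, 2). Define ε(Λ) := inf{ ε > 0 : ν({|y| > ε}) < Λ } and f(Λ) := Λ · ε(Λ)^n. Then f is regularly varying at infinity with index 1 − n/α, and there exist constants 0 < c̲ ≤ c̄ < ∞ and Λ_0 > 0 such that for all Λ ≥ Λ_0, c̲ f(Λ) ≤ E_n(Λ) ≤ c̄ f(Λ), where E_n(Λ) is the optimal value of problem Ω_{n,Λ}. -/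
open MeasureTheory Filter Set
open scoped ENNReal

/-- `E_n(Λ)`: the optimal value of problem `Ω_{n,Λ}`. -/
noncomputable def optValue (n : ℕ) (ν : Measure ℝ) (Λ : ℝ) : ℝ≥0∞ :=
  ⨅ (νb : Measure ℝ) (_ : Constraint n ν Λ νb), Jfun n ν νb

/-- `ε(Λ) = inf { ε > 0 : ν({|y| > ε}) < Λ }`. -/
noncomputable def epsOf (ν : Measure ℝ) (Λ : ℝ) : ℝ :=
  sInf {e : ℝ | 0 < e ∧ ν {y : ℝ | e < |y|} < ENNReal.ofReal Λ}

open scoped Topology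

/-- The two-sided tail `x ↦ ν({|y| > x})` as a real-valued function. -/
noncomputable def tailReal (ν : Measure ℝ) (x : ℝ) : ℝ := (ν {y : ℝ | x < |y|}).toReal

lemma measurableSet_lt_abs (x : ℝ) : MeasurableSet {y : ℝ | x < |y|} :=
  measurableSet_lt measurable_const continuous_abs.measurable

lemma measurableSet_abs_le (x : ℝ) : MeasurableSet {y : ℝ | |y| ≤ x} :=
  measurableSet_le continuous_abs.measurable measurable_const

lemma compl_abs_le (x : ℝ) : {y : ℝ | |y| ≤ x}ᶜ = {y : ℝ | x < |y|} := by
  ext y; simp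

lemma tailReal_nonneg (ν : Measure ℝ) (x : ℝ) : 0 ≤ tailReal ν x := ENNReal.toReal_nonneg

lemma integrable_pow_of_lintegral_lt_top {ν : Measure ℝ} {k : ℕ}
    (h : (∫⁻ y, ENNReal.ofReal (|y| ^ k) ∂ν) < ⊤) : Integrable (fun y : ℝ => y ^ k) ν := by
  refine ⟨(continuous_pow k).aestronglyMeasurable, ?_⟩
  rw [hasFiniteIntegral_iff_norm]
  simpa [norm_pow] using h

lemma measure_lt_abs_lt_top {ν : Measure ℝ}
    (h : (∫⁻ y, ENNReal.ofReal (|y| ^ 2) ∂ν) < ⊤) {x : ℝ} (hx : 0 < x) :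
    ν {y : ℝ | x < |y|} < ⊤ := by
  have hx2 : ENNReal.ofReal (x ^ 2) ≠ 0 := by simp [hx.ne']
  have hfin := meas_ge_le_lintegral_div (μ := ν) (f := fun y : ℝ => ENNReal.ofReal (|y| ^ 2))
    (by fun_prop) hx2 ENNReal.ofReal_ne_top
  refine lt_of_le_of_lt (measure_mono fun y hy => ?_)
    (hfin.trans_lt (ENNReal.div_lt_top h.ne hx2))
  exact ENNReal.ofReal_le_ofReal (pow_le_pow_left₀ hx.le (le_of_lt hy) 2)

lemma tailReal_anti {ν : Measure ℝ} (hfin : ∀ x, 0 < x → ν {y : ℝ | x < |y|} < ⊤)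
    {x z : ℝ} (hx : 0 < x) (hxz : x ≤ z) : tailReal ν z ≤ tailReal ν x :=
  ENNReal.toReal_mono (hfin x hx).ne (measure_mono fun _ hy => lt_of_le_of_lt hxz hy)

lemma tendsto_tailReal_atTop {ν : Measure ℝ} (hν0 : ν {0} = 0) (hνinf : ν Set.univ = ⊤)
    (hfin : ∀ x, 0 < x → ν {y : ℝ | x < |y|} < ⊤) :
    Tendsto (tailReal ν) (𝓝[>] 0) atTop := by
  have hunion : ν (⋃ k : ℕ, {y : ℝ | 1 / ((k : ℝ) + 1) < |y|}) = ⊤ := by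
    have hset : (⋃ k : ℕ, {y : ℝ | 1 / ((k : ℝ) + 1) < |y|}) = {0}ᶜ := by
      ext y
      simp only [mem_iUnion, mem_ofPred_eq, mem_compl_iff, mem_singleton_iff]
      constructor
      · rintro ⟨k, hk⟩ rfl
        have : (0 : ℝ) < 1 / ((k : ℝ) + 1) := by positivity
        simp only [abs_zero] at hk
        linarith
      · intro hy
        exact exists_nat_one_div_lt (abs_pos.2 hy)
    rw [hset]
    have huniv := measure_add_measure_compl (μ := ν) (measurableSet_singleton (0 : ℝ))
    rwa [hν0, zero_add, hνinf] at huniv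
  have hmono : Monotone fun k : ℕ => {y : ℝ | 1 / ((k : ℝ) + 1) < |y|} := by
    intro k l hkl y hy
    exact lt_of_le_of_lt (b := 1 / ((k : ℝ) + 1)) (Nat.one_div_le_one_div hkl) hy
  have hlim := tendsto_measure_iUnion_atTop (μ := ν) hmono
  rw [hunion] at hlim
  rw [tendsto_atTop]
  intro M
  obtain ⟨k, hk⟩ := (hlim.eventually (lt_mem_nhds (ENNReal.ofReal_lt_top (r := M)))).exists
  have hk0 : (0 : ℝ) < 1 / ((k : ℝ) + 1) := by positivity
  filter_upwards [Ioo_mem_nhdsGT hk0] with x hx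
  refine le_trans ?_ (tailReal_anti hfin hx.1 hx.2.le)
  exact (ENNReal.ofReal_le_iff_le_toReal (hfin _ hk0).ne).1 hk.le

/-- The truncated second moment `∫_{|y| ≤ x} y² ν(dy)`. -/
noncomputable def truncSq (ν : Measure ℝ) (x : ℝ) : ℝ := ∫ y in {y : ℝ | |y| ≤ x}, y ^ 2 ∂ν

lemma truncSq_le_half_add {ν : Measure ℝ} (hsq : Integrable (fun y : ℝ => y ^ 2) ν)
    (hfin : ∀ x, 0 < x → ν {y : ℝ | x < |y|} < ⊤) {x : ℝ} (hx : 0 < x) :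
    truncSq ν x ≤ truncSq ν (x / 2) + x ^ 2 * tailReal ν (x / 2) := by
  have hunion : {y : ℝ | |y| ≤ x} = {y : ℝ | |y| ≤ x / 2} ∪ {y : ℝ | x / 2 < |y| ∧ |y| ≤ x} := by
    ext y
    simp only [mem_ofPred_eq, mem_union]
    constructor
    · intro h
      rcases le_or_gt |y| (x / 2) with h' | h'
      · exact Or.inl h'
      · exact Or.inr ⟨h', h⟩
    · rintro (h | h)
      · linarith
      · exact h.2
  have hdisj : Disjoint {y : ℝ | |y| ≤ x / 2} {y : ℝ | x / 2 < |y| ∧ |y| ≤ x} := by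
    rw [Set.disjoint_left]
    intro y h1 h2
    exact absurd h2.1 (not_lt.2 h1)
  have hmeas : MeasurableSet {y : ℝ | x / 2 < |y| ∧ |y| ≤ x} :=
    (measurableSet_lt_abs _).inter (measurableSet_abs_le _)
  have hsub : ν {y : ℝ | x / 2 < |y| ∧ |y| ≤ x} ≤ ν {y : ℝ | x / 2 < |y|} :=
    measure_mono fun _ h => h.1
  have hlt := hfin (x / 2) (by positivity)
  unfold truncSq
  rw [hunion, setIntegral_union hdisj hmeas hsq.integrableOn hsq.integrableOn]
  gcongr
  refine (Real.le_norm_self _).trans ((norm_setIntegral_le_of_norm_le_const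
    (C := x ^ 2) (lt_of_le_of_lt hsub hlt) ?_).trans ?_)
  · intro y hy
    rw [norm_pow, Real.norm_eq_abs]
    exact pow_le_pow_left₀ (abs_nonneg y) hy.2 2
  · gcongr
    exact ENNReal.toReal_mono hlt.ne hsub

lemma tendsto_truncSq_half_pow {ν : Measure ℝ} (hsq : Integrable (fun y : ℝ => y ^ 2) ν) {x : ℝ}
    (hx : 0 < x) : Tendsto (fun m : ℕ => truncSq ν (x / 2 ^ m)) atTop (𝓝 0) := by
  have hanti : Antitone fun m : ℕ => {y : ℝ | |y| ≤ x / 2 ^ m} := by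
    intro k l hkl y hy
    refine le_trans hy (div_le_div_of_nonneg_left hx.le (by positivity) ?_)
    exact pow_le_pow_right₀ (by norm_num) hkl
  have hlim := tendsto_setIntegral_of_antitone (μ := ν) (f := fun y : ℝ => y ^ 2)
    (fun m => measurableSet_abs_le (x / 2 ^ m)) hanti ⟨0, hsq.integrableOn⟩
  have hzero : ∫ y in ⋂ m : ℕ, {y : ℝ | |y| ≤ x / 2 ^ m}, y ^ 2 ∂ν = 0 := by
    apply setIntegral_eq_zero_of_forall_eq_zero
    intro y hy
    simp only [mem_iInter, mem_ofPred_eq] at hy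
    have hgeom : Tendsto (fun m : ℕ => x / (2 : ℝ) ^ m) atTop (𝓝 0) :=
      tendsto_const_nhds.div_atTop (tendsto_pow_atTop_atTop_of_one_lt one_lt_two)
    have : |y| ≤ 0 := ge_of_tendsto' hgeom hy
    have : y = 0 := abs_eq_zero.1 (le_antisymm this (abs_nonneg y))
    simp [this]
  rw [hzero] at hlim
  exact hlim

/-- A Karamata-type bound: the truncated second moment is dominated by `x²` times the tail. -/
lemma truncSq_le_mul_tailReal {ν : Measure ℝ} (hsq : Integrable (fun y : ℝ => y ^ 2) ν)
    (hfin : ∀ x, 0 < x → ν {y : ℝ | x < |y|} < ⊤) {q x₀ : ℝ} (hq0 : 0 < q) (hq4 : q < 4)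
    (hq : ∀ x, 0 < x → x ≤ x₀ → tailReal ν (x / 2) ≤ q * tailReal ν x) :
    ∀ x, 0 < x → x ≤ x₀ → truncSq ν x ≤ 4 * q / (4 - q) * (x ^ 2 * tailReal ν x) := by
  set C : ℝ := 4 * q / (4 - q) with hC
  have hCq : C * q / 4 + q = C := by
    have : 4 - q ≠ 0 := by linarith
    rw [hC]; field_simp; ring
  have hC0 : 0 < C := div_pos (by positivity) (by linarith)
  have hiter : ∀ m : ℕ, ∀ x, 0 < x → x ≤ x₀ →
      truncSq ν x ≤ truncSq ν (x / 2 ^ m) + C * (x ^ 2 * tailReal ν x) := by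
    intro m
    induction m with
    | zero =>
      intro x hx _
      have := tailReal_nonneg ν x
      have : 0 ≤ C * (x ^ 2 * tailReal ν x) := by positivity
      simpa using this
    | succ m ih =>
      intro x hx hx0
      have hrec := truncSq_le_half_add hsq hfin hx
      have hih := ih (x / 2) (by positivity) (by linarith)
      have hxm : x / 2 / 2 ^ m = x / 2 ^ (m + 1) := by
        rw [div_div, pow_succ, mul_comm]
      rw [hxm] at hih
      have hstep : (C / 4 + 1) * x ^ 2 * tailReal ν (x / 2)
          ≤ (C / 4 + 1) * x ^ 2 * (q * tailReal ν x) :=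
        mul_le_mul_of_nonneg_left (hq x hx hx0) (by positivity)
      have heq : (C / 4 + 1) * x ^ 2 * (q * tailReal ν x)
          = (C * q / 4 + q) * (x ^ 2 * tailReal ν x) := by ring
      rw [heq, hCq] at hstep
      nlinarith
  intro x hx hx0
  have hlim := (tendsto_truncSq_half_pow hsq hx).add_const (C * (x ^ 2 * tailReal ν x))
  rw [zero_add] at hlim
  exact ge_of_tendsto' hlim fun m => hiter m x hx hx0

/-- Linear systems whose matrix is close to a fixed invertible matrix are solvable, with a uniform
bound on the solution. -/
lemma exists_bounded_solution_near {N : ℕ} (V : Matrix (Fin N) (Fin N) ℝ) (hV : V.det ≠ 0) :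
    ∃ η > 0, ∃ C > 0, ∀ A : Matrix (Fin N) (Fin N) ℝ, (∀ i j, |A i j - V i j| ≤ η) →
      ∀ (d : Fin N → ℝ) (δ : ℝ), (∀ i, |d i| ≤ δ) →
        ∃ c : Fin N → ℝ, A.mulVec c = d ∧ ∀ i, |c i| ≤ C * δ := by
  have hcont : ContinuousAt (Inv.inv : Matrix (Fin N) (Fin N) ℝ → Matrix (Fin N) (Fin N) ℝ) V := by
    apply continuousAt_matrix_inv
    exact NormedRing.inverse_continuousAt (Units.mk0 _ hV)
  have hdet : ∀ᶠ A in 𝓝 V, A.det ≠ 0 :=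
    (continuous_id.matrix_det.continuousAt (x := V)).eventually_ne hV
  have hentry : ∀ᶠ A in 𝓝 V, ∀ i j, |A⁻¹ i j - V⁻¹ i j| < 1 := by
    rw [eventually_all]
    intro i
    rw [eventually_all]
    intro j
    have hij : ContinuousAt (fun A : Matrix (Fin N) (Fin N) ℝ => A⁻¹ i j) V :=
      ((continuous_apply_apply i j).continuousAt).comp hcont
    have := Metric.continuousAt_iff'.1 hij 1 one_pos
    simpa [Real.dist_eq] using this
  have hnear : ∃ η > 0, ∀ A : Matrix (Fin N) (Fin N) ℝ, (∀ i j, |A i j - V i j| ≤ η) →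
      A.det ≠ 0 ∧ ∀ i j, |A⁻¹ i j - V⁻¹ i j| < 1 := by
    have hev : ∀ᶠ A : Fin N → Fin N → ℝ in 𝓝 (V : Fin N → Fin N → ℝ),
      (Matrix.of A).det ≠ 0 ∧ ∀ i j, |(Matrix.of A)⁻¹ i j - V⁻¹ i j| < 1 := hdet.and hentry
    obtain ⟨η, hη, hball⟩ := Metric.eventually_nhds_iff.1 hev
    refine ⟨η / 2, by positivity, fun A hA => hball (y := A) ?_⟩
    refine lt_of_le_of_lt ?_ (half_lt_self hη)
    refine (dist_pi_le_iff (half_pos hη).le).2 fun i => ?_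
    exact (dist_pi_le_iff (half_pos hη).le).2 fun j => hA i j
  obtain ⟨η, hη, hnear⟩ := hnear
  refine ⟨η, hη, (∑ i, ∑ j, (|V⁻¹ i j| + 1)) + 1, by positivity, fun A hA d δ hd => ?_⟩
  obtain ⟨hdetA, hinv⟩ := hnear A hA
  refine ⟨A⁻¹.mulVec d, ?_, fun i => ?_⟩
  · rw [Matrix.mulVec_mulVec, Matrix.mul_nonsing_inv _ (isUnit_iff_ne_zero.2 hdetA),
      Matrix.one_mulVec]
  · have hδ : 0 ≤ δ := (abs_nonneg _).trans (hd i)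
    calc |A⁻¹.mulVec d i| = |∑ j, A⁻¹ i j * d j| := rfl
      _ ≤ ∑ j, |A⁻¹ i j * d j| := Finset.abs_sum_le_sum_abs _ _
      _ ≤ ∑ j, (|V⁻¹ i j| + 1) * δ := by
        refine Finset.sum_le_sum fun j _ => ?_
        rw [abs_mul]
        have h1 : |A⁻¹ i j| ≤ |V⁻¹ i j| + 1 := by
          have := abs_sub_abs_le_abs_sub (A⁻¹ i j) (V⁻¹ i j)
          have := hinv i j
          linarith
        exact mul_le_mul h1 (hd j) (abs_nonneg _) (by positivity)
      _ = (∑ j, (|V⁻¹ i j| + 1)) * δ := (Finset.sum_mul _ _ _).symm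
      _ ≤ ((∑ i, ∑ j, (|V⁻¹ i j| + 1)) + 1) * δ := by
        refine mul_le_mul_of_nonneg_right ?_ hδ
        have := Finset.single_le_sum (f := fun i => ∑ j, (|V⁻¹ i j| + 1))
          (fun i _ => by positivity) (Finset.mem_univ i)
        linarith

lemma det_pow_add_two_ne_zero {N : ℕ} {v : Fin N → ℝ} (hv : Function.Injective v)
    (hv0 : ∀ i, v i ≠ 0) :
    (Matrix.of fun k i : Fin N => v i ^ ((k : ℕ) + 2)).det ≠ 0 := by
  have hfac : (Matrix.of fun k i : Fin N => v i ^ ((k : ℕ) + 2))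
      = (Matrix.vandermonde v).transpose * Matrix.diagonal fun i => v i ^ 2 := by
    ext k i
    simp [Matrix.mul_diagonal, Matrix.vandermonde_apply, pow_add]
  rw [hfac, Matrix.det_mul, Matrix.det_transpose, Matrix.det_diagonal]
  exact mul_ne_zero (Matrix.det_vandermonde_ne_zero_iff.2 hv)
    (Finset.prod_ne_zero_iff.2 fun i _ => pow_ne_zero 2 (hv0 i))

lemma tailReal_lt_of_epsOf_lt {ν : Measure ℝ} (hfin : ∀ x, 0 < x → ν {y : ℝ | x < |y|} < ⊤)
    {Λ x : ℝ} (hΛ : tailReal ν 1 < Λ) (hx : epsOf ν Λ < x) : tailReal ν x < Λ := by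
  have hne : {e : ℝ | 0 < e ∧ ν {y : ℝ | e < |y|} < ENNReal.ofReal Λ}.Nonempty :=
    ⟨1, one_pos, (ENNReal.lt_ofReal_iff_toReal_lt (hfin 1 one_pos).ne).2 hΛ⟩
  obtain ⟨e, he, hex⟩ := exists_lt_of_csInf_lt hne hx
  exact lt_of_le_of_lt (tailReal_anti hfin he.1 hex.le)
    ((ENNReal.lt_ofReal_iff_toReal_lt (hfin e he.1).ne).1 he.2)

lemma epsOf_le_of_tailReal_lt {ν : Measure ℝ} (hfin : ∀ x, 0 < x → ν {y : ℝ | x < |y|} < ⊤)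
    {Λ x : ℝ} (hx0 : 0 < x) (hx : tailReal ν x < Λ) : epsOf ν Λ ≤ x :=
  csInf_le ⟨0, fun _ he => he.1.le⟩
    ⟨hx0, (ENNReal.lt_ofReal_iff_toReal_lt (hfin x hx0).ne).2 hx⟩

lemma tendsto_epsOf {ν : Measure ℝ} (hfin : ∀ x, 0 < x → ν {y : ℝ | x < |y|} < ⊤)
    (htop : Tendsto (tailReal ν) (𝓝[>] 0) atTop) : Tendsto (epsOf ν) atTop (𝓝[>] 0) := by
  have hpos : ∀ᶠ Λ in atTop, 0 < epsOf ν Λ := by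
    filter_upwards [eventually_gt_atTop (tailReal ν 1)] with Λ hΛ
    obtain ⟨x, hxΛ, hx0⟩ :=
      ((htop.eventually_ge_atTop Λ).and self_mem_nhdsWithin).exists
    refine lt_of_lt_of_le (show (0 : ℝ) < x from hx0) (not_lt.1 fun hlt => ?_)
    exact absurd (tailReal_lt_of_epsOf_lt hfin hΛ hlt) (not_lt.2 hxΛ)
  rw [tendsto_nhdsWithin_iff]
  refine ⟨?_, hpos⟩
  rw [tendsto_order]
  constructor
  · intro a ha
    filter_upwards [hpos] with Λ hΛ using ha.trans hΛ
  · intro a ha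
    filter_upwards [eventually_gt_atTop (tailReal ν (a / 2))] with Λ hΛ
    exact lt_of_le_of_lt (epsOf_le_of_tailReal_lt hfin (half_pos ha) hΛ) (half_lt_self ha)

/-- The generalized inverse of a function regularly varying at `0` with index `-α` is regularly
varying at infinity with index `-1/α`. -/
lemma tendsto_inverse_ratio {T ε : ℝ → ℝ} {α : ℝ} (hα : 0 < α)
    (hT : ∀ c : ℝ, 0 < c → Tendsto (fun x => T (c * x) / T x) (𝓝[>] 0) (𝓝 (c ^ (-α))))
    (hTpos : ∀ᶠ x in 𝓝[>] 0, 0 < T x) (hε : Tendsto ε atTop (𝓝[>] 0))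
    (hlt : ∀ᶠ Λ in atTop, ∀ x, ε Λ < x → T x < Λ)
    (hle : ∀ᶠ Λ in atTop, ∀ x, 0 < x → T x < Λ → ε Λ ≤ x) {c : ℝ} (hc : 0 < c) :
    Tendsto (fun Λ => ε (c * Λ) / ε Λ) atTop (𝓝 (c ^ (-(1 / α)))) := by
  set L : ℝ := c ^ (-(1 / α)) with hL
  have hL0 : 0 < L := Real.rpow_pos_of_pos hc _
  have hLc : L ^ (-α) = c := by
    rw [hL, ← Real.rpow_mul hc.le]
    have : -(1 / α) * -α = 1 := by field_simp
    rw [this, Real.rpow_one]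
  have hεpos : ∀ᶠ Λ in atTop, 0 < ε Λ := hε.eventually self_mem_nhdsWithin
  have hcΛ : Tendsto (fun Λ : ℝ => c * Λ) atTop atTop := tendsto_id.const_mul_atTop hc
  have hscale : ∀ β : ℝ, 0 < β → Tendsto (fun Λ => β * ε Λ) atTop (𝓝[>] 0) := by
    intro β hβ
    rw [tendsto_nhdsWithin_iff] at hε ⊢
    refine ⟨by simpa using hε.1.const_mul β, ?_⟩
    filter_upwards [hε.2] with Λ hΛ using mul_pos hβ hΛ
  rw [tendsto_order]
  constructor
  · intro k hk
    obtain ⟨k₁, hk₁, hk₁L⟩ := exists_between (max_lt hk hL0)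
    obtain ⟨m, hkm, hmL⟩ := exists_between hk₁L
    have hk₁0 : 0 < k₁ := (le_max_right _ _).trans_lt hk₁
    have hm0 : 0 < m := hk₁0.trans hkm
    have hcm : c < m ^ (-α) := by
      rw [← hLc]
      exact Real.rpow_lt_rpow_of_neg hm0 hmL (by linarith)
    have hβ : 0 < k₁ / m := div_pos hk₁0 hm0
    have hβ1 : k₁ / m < 1 := (div_lt_one hm0).2 hkm
    have hz := hscale _ hβ
    filter_upwards [hεpos, hz.eventually hTpos, hz.eventually ((hT m hm0).eventually_const_lt hcm),
      hle, hcΛ.eventually hlt] with Λ hε0 hTz hTm hleΛ hltΛ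
    rw [lt_div_iff₀ hTz] at hTm
    have hmul : m * (k₁ / m * ε Λ) = k₁ * ε Λ := by field_simp
    rw [hmul] at hTm
    have hΛT : Λ ≤ T (k₁ / m * ε Λ) := by
      by_contra hcon
      have := hleΛ _ (mul_pos hβ hε0) (not_le.1 hcon)
      nlinarith
    have hge : k₁ * ε Λ ≤ ε (c * Λ) := by
      by_contra hcon
      have := hltΛ _ (not_le.1 hcon)
      nlinarith
    rw [lt_div_iff₀ hε0]
    have : k < k₁ := (le_max_left _ _).trans_lt hk₁
    nlinarith
  · intro k hk
    obtain ⟨k₁, hLk₁, hk₁⟩ := exists_between hk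
    obtain ⟨m, hLm, hmk⟩ := exists_between hLk₁
    have hm0 : 0 < m := hL0.trans hLm
    have hk₁0 : 0 < k₁ := hm0.trans hmk
    have hcm : m ^ (-α) < c := by
      rw [← hLc]
      exact Real.rpow_lt_rpow_of_neg hL0 hLm (by linarith)
    have hβ : 0 < k₁ / m := div_pos hk₁0 hm0
    have hβ1 : 1 < k₁ / m := (one_lt_div hm0).2 hmk
    have hz := hscale _ hβ
    filter_upwards [hεpos, hz.eventually hTpos, hz.eventually ((hT m hm0).eventually_lt_const hcm),
      hlt, hcΛ.eventually hle] with Λ hε0 hTz hTm hltΛ hleΛ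
    rw [div_lt_iff₀ hTz] at hTm
    have hmul : m * (k₁ / m * ε Λ) = k₁ * ε Λ := by field_simp
    rw [hmul] at hTm
    have hΛT : T (k₁ / m * ε Λ) < Λ := hltΛ _ (by nlinarith)
    have hge : ε (c * Λ) ≤ k₁ * ε Λ := hleΛ _ (mul_pos hk₁0 hε0) (by nlinarith)
    rw [div_lt_iff₀ hε0]
    nlinarith

/-- Comparing `ν` with a reweighting of `ν` plus an atom at the origin. -/
lemma Jfun_withDensity_add_dirac_le {n : ℕ} (hn : n ≠ 0) (ν : Measure ℝ) {D : ℝ → ℝ}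
    (hD : Measurable D) (m : ℝ≥0∞) :
    Jfun n ν (ν.withDensity (fun y => ENNReal.ofReal (D y)) + m • Measure.dirac 0)
      ≤ ∫⁻ y, ENNReal.ofReal |D y - 1| * ENNReal.ofReal (|y| ^ n) ∂ν := by
  set κ := ν.withDensity fun y => ENNReal.ofReal (D y) with hκ
  set ω := ν.withDensity fun y => ENNReal.ofReal (min 1 (D y)) with hω
  set lo := ν.withDensity fun y => ENNReal.ofReal (1 - D y) with hlo
  set hi := ν.withDensity fun y => ENNReal.ofReal (D y - 1) with hhi
  have hωinf : ω ≤ ν ⊓ (κ + m • Measure.dirac 0) := by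
    refine le_inf ?_ (Measure.le_add_right ?_)
    · conv_rhs => rw [← withDensity_one (μ := ν)]
      refine withDensity_mono (ae_of_all _ fun y => ?_)
      simp
    · refine withDensity_mono (ae_of_all _ fun y => ?_)
      exact ENNReal.ofReal_le_ofReal (min_le_right _ _)
  have hνle : ν ≤ lo + ω := by
    rw [hlo, hω, ← withDensity_add_left (by fun_prop)]
    conv_lhs => rw [← withDensity_one (μ := ν)]
    refine withDensity_mono (ae_of_all _ fun y => ?_)
    simp only [Pi.one_apply, Pi.add_apply]
    rw [← ENNReal.ofReal_one]
    rcases le_total 1 (D y) with h | h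
    · rw [min_eq_left h]; exact le_add_self
    · rw [min_eq_right h]
      refine le_trans (ENNReal.ofReal_le_ofReal ?_) ENNReal.ofReal_add_le
      linarith
  have hκle : κ ≤ hi + ω := by
    rw [hκ, hhi, hω, ← withDensity_add_left (by fun_prop)]
    refine withDensity_mono (ae_of_all _ fun y => ?_)
    simp only [Pi.add_apply]
    rcases le_total 1 (D y) with h | h
    · rw [min_eq_left h]
      refine le_trans (ENNReal.ofReal_le_ofReal ?_) ENNReal.ofReal_add_le
      linarith
    · rw [min_eq_right h]; exact le_add_self
  have htv : tvDist ν (κ + m • Measure.dirac 0) ≤ lo + (hi + m • Measure.dirac 0) := by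
    refine add_le_add (Measure.sub_le_of_le_add (hνle.trans (by gcongr)))
      (Measure.sub_le_of_le_add ?_)
    calc κ + m • Measure.dirac 0 ≤ (hi + ω) + m • Measure.dirac 0 := by gcongr
      _ = (hi + m • Measure.dirac 0) + ω := by abel
      _ ≤ _ := by gcongr
  have hf : Measurable fun y : ℝ => ENNReal.ofReal (|y| ^ n) := by fun_prop
  refine (lintegral_mono' htv le_rfl).trans (le_of_eq ?_)
  rw [lintegral_add_measure, lintegral_add_measure, lintegral_smul_measure, lintegral_dirac,
    lintegral_withDensity_eq_lintegral_mul _ (by fun_prop) hf,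
    lintegral_withDensity_eq_lintegral_mul _ (by fun_prop) hf]
  simp only [abs_zero, zero_pow hn, ENNReal.ofReal_zero, smul_zero, add_zero]
  rw [← lintegral_add_left (by fun_prop)]
  refine lintegral_congr fun y => ?_
  simp only [Pi.mul_apply]
  rw [← add_mul]
  congr 1
  rcases le_total 1 (D y) with h | h
  · rw [ENNReal.ofReal_of_nonpos (sub_nonpos.2 h), zero_add, abs_of_nonneg (sub_nonneg.2 h)]
  · rw [ENNReal.ofReal_of_nonpos (sub_nonpos.2 h), add_zero, abs_sub_comm,
      abs_of_nonneg (sub_nonneg.2 h)]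

/-- Removing the jumps smaller than `ρ`, compensating their moments by reweighting `ν` on the sets
`B i`, and adjusting the total mass by an atom at the origin, gives an upper bound on the optimal
value. -/
lemma optValue_le_of_reweighting {n : ℕ} (hn : 2 ≤ n) {ν : Measure ℝ}
    (hint : ∀ k, 2 ≤ k → k ≤ n → Integrable (fun y : ℝ => y ^ k) ν)
    (hfin : ∀ x, 0 < x → ν {y : ℝ | x < |y|} < ⊤) {ι : Type*} [Fintype ι] {B : ι → Set ℝ}
    (hB : ∀ i, MeasurableSet (B i)) {w : ι → ℝ} (hw : ∑ i, |w i| ≤ 1) {ρ R : ℝ} (hρ : 0 < ρ)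
    (hρR : ρ ≤ R) (hBlo : ∀ i, ∀ y ∈ B i, ρ < |y|) (hBhi : ∀ i, ∀ y ∈ B i, |y| ≤ R)
    (hmatch : ∀ k, 2 ≤ k → k ≤ n - 1 →
      ∑ i, w i * ∫ y in B i, y ^ k ∂ν = ∫ y in {y : ℝ | |y| ≤ ρ}, y ^ k ∂ν)
    {Λ : ℝ} (hΛ : 2 * tailReal ν ρ ≤ Λ) :
    optValue n ν Λ ≤ ∫⁻ y in {y : ℝ | |y| ≤ R}, ENNReal.ofReal (|y| ^ n) ∂ν := by
  set A : Set ℝ := {y : ℝ | ρ < |y|} with hA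
  have hAm : MeasurableSet A := measurableSet_lt_abs ρ
  set s : ℝ → ℝ := fun y => ∑ i, (B i).indicator (fun _ => w i) y with hs
  set D : ℝ → ℝ := fun y => A.indicator (fun _ => 1) y + s y with hD
  have hsm : Measurable s :=
    Finset.measurable_fun_sum _ fun i _ => measurable_const.indicator (hB i)
  have hDm : Measurable D := (measurable_const.indicator hAm).add hsm
  have hsabs : ∀ y, |s y| ≤ 1 := by
    intro y
    refine (Finset.abs_sum_le_sum_abs _ _).trans ((Finset.sum_le_sum fun i _ => ?_).trans hw)
    by_cases hy : y ∈ B i <;> simp [hy]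
  have hszero : ∀ y, (∀ i, y ∉ B i) → s y = 0 := by
    intro y hy
    exact Finset.sum_eq_zero fun i _ => indicator_of_notMem (hy i) _
  have hDin : ∀ y ∈ A, D y = 1 + s y := by
    intro y hy
    simp [hD, hy]
  have hDout : ∀ y, y ∉ A → D y = 0 := by
    intro y hy
    have := hszero y fun i hi => hy (hBlo i y hi)
    simp [hD, hy, this]
  have hDnonneg : ∀ y, 0 ≤ D y := by
    intro y
    by_cases hy : y ∈ A
    · rw [hDin y hy]; linarith [(abs_le.1 (hsabs y)).1]
    · rw [hDout y hy]
  set κ := ν.withDensity fun y => ENNReal.ofReal (D y) with hκ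
  have hκmass : κ univ ≤ ENNReal.ofReal Λ := by
    rw [hκ, withDensity_apply _ MeasurableSet.univ, setLIntegral_univ]
    calc ∫⁻ y, ENNReal.ofReal (D y) ∂ν ≤ ∫⁻ y, A.indicator (fun _ => 2) y ∂ν := by
          refine lintegral_mono fun y => ?_
          by_cases hy : y ∈ A
          · rw [hDin y hy, indicator_of_mem hy, show (2 : ℝ≥0∞) = ENNReal.ofReal 2 by simp]
            exact ENNReal.ofReal_le_ofReal (by linarith [(abs_le.1 (hsabs y)).2])
          · simp [hDout y hy]
      _ = ENNReal.ofReal (2 * tailReal ν ρ) := by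
          rw [lintegral_indicator_const hAm, ENNReal.ofReal_mul (by norm_num), tailReal,
            ENNReal.ofReal_toReal (hfin ρ hρ).ne]
          simp [hA]
      _ ≤ ENNReal.ofReal Λ := ENNReal.ofReal_le_ofReal hΛ
  set m : ℝ≥0∞ := ENNReal.ofReal Λ - κ univ with hm
  have hmass : (κ + m • Measure.dirac 0 : Measure ℝ) univ = ENNReal.ofReal Λ := by
    simp only [Measure.add_apply, Measure.smul_apply, measure_univ, smul_eq_mul, mul_one]
    exact add_tsub_cancel_of_le hκmass
  have hmtop : m ≠ ⊤ := ENNReal.sub_ne_top ENNReal.ofReal_ne_top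
  have hcon : Constraint n ν Λ (κ + m • Measure.dirac 0) := by
    refine ⟨⟨by rw [hmass]; exact ENNReal.ofReal_lt_top⟩, hmass, fun k hk2 hkn => ?_⟩
    have hk := hint k hk2 (hkn.trans (Nat.sub_le _ _))
    have hdens : ∀ y : ℝ, (ENNReal.ofReal (D y)).toReal • y ^ k
        = A.indicator (fun y => y ^ k) y + ∑ i, w i * (B i).indicator (fun y => y ^ k) y := by
      intro y
      rw [ENNReal.toReal_ofReal (hDnonneg y), smul_eq_mul, hD]
      simp only [hs, add_mul, Finset.sum_mul]
      congr 1
      · by_cases hy : y ∈ A <;> simp [hy]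
      · refine Finset.sum_congr rfl fun i _ => ?_
        by_cases hy : y ∈ B i <;> simp [hy]
    have hintA : Integrable (A.indicator fun y : ℝ => y ^ k) ν := hk.indicator hAm
    have hintB : ∀ i, Integrable (fun y => w i * (B i).indicator (fun y : ℝ => y ^ k) y) ν :=
      fun i => (hk.indicator (hB i)).const_mul _
    have hofm : Measurable fun y => ENNReal.ofReal (D y) := hDm.ennreal_ofReal
    have hlt : ∀ᵐ y ∂ν, ENNReal.ofReal (D y) < ⊤ := ae_of_all _ fun _ => ENNReal.ofReal_lt_top
    have hintκ : Integrable (fun y : ℝ => y ^ k) κ := by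
      rw [hκ, integrable_withDensity_iff_integrable_smul' hofm hlt]
      simp_rw [hdens]
      exact hintA.add (integrable_finsetSum _ fun i _ => hintB i)
    have hintδ : Integrable (fun y : ℝ => y ^ k) (m • Measure.dirac 0) :=
      (integrable_dirac (by simp)).smul_measure hmtop
    refine ⟨hintκ.add_measure hintδ, ?_⟩
    rw [integral_add_measure hintκ hintδ, integral_smul_measure, integral_dirac,
      zero_pow (by omega), smul_zero, add_zero, hκ,
      integral_withDensity_eq_integral_toReal_smul hofm hlt]
    simp_rw [hdens]
    rw [integral_add hintA (integrable_finsetSum _ fun i _ => hintB i),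
      integral_finsetSum _ fun i _ => hintB i, integral_indicator hAm]
    have hsum : ∑ i, ∫ y, w i * (B i).indicator (fun y : ℝ => y ^ k) y ∂ν
        = ∫ y in {y : ℝ | |y| ≤ ρ}, y ^ k ∂ν := by
      rw [← hmatch k hk2 hkn]
      refine Finset.sum_congr rfl fun i _ => ?_
      rw [integral_const_mul, integral_indicator (hB i)]
    rw [hsum, ← integral_add_compl (measurableSet_abs_le ρ) hk, compl_abs_le, add_comm]
  refine (iInf₂_le _ hcon).trans ((Jfun_withDensity_add_dirac_le (by omega) ν hDm m).trans ?_)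
  rw [← lintegral_indicator (measurableSet_abs_le R)]
  refine lintegral_mono fun y => ?_
  by_cases hyR : |y| ≤ R
  · rw [indicator_of_mem (show y ∈ {y : ℝ | |y| ≤ R} from hyR)]
    refine mul_le_of_le_one_left' ?_
    rw [← ENNReal.ofReal_one]
    refine ENNReal.ofReal_le_ofReal ?_
    by_cases hy : y ∈ A
    · rw [hDin y hy]; simpa using hsabs y
    · rw [hDout y hy]; simp
  · have hy : y ∈ A := lt_of_le_of_lt hρR (not_le.1 hyR)
    have hs0 := hszero y fun i hi => hyR (hBhi i y hi)
    rw [hDin y hy, hs0]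
    simp

lemma setLIntegral_abs_pow_le {n : ℕ} (hn : 2 ≤ n) {ν : Measure ℝ}
    (hsq : Integrable (fun y : ℝ => y ^ 2) ν) {R : ℝ} (hR : 0 ≤ R) :
    ∫⁻ y in {y : ℝ | |y| ≤ R}, ENNReal.ofReal (|y| ^ n) ∂ν
      ≤ ENNReal.ofReal (R ^ (n - 2) * truncSq ν R) := by
  have hle : ∫⁻ y in {y : ℝ | |y| ≤ R}, ENNReal.ofReal (|y| ^ n) ∂ν
      ≤ ∫⁻ y in {y : ℝ | |y| ≤ R}, ENNReal.ofReal (R ^ (n - 2) * y ^ 2) ∂ν := by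
    refine setLIntegral_mono' (measurableSet_abs_le R) fun y hy => ENNReal.ofReal_le_ofReal ?_
    rw [← sq_abs y, ← Nat.sub_add_cancel hn, pow_add, Nat.add_sub_cancel]
    exact mul_le_mul_of_nonneg_right (pow_le_pow_left₀ (abs_nonneg y) hy _) (by positivity)
  refine hle.trans (le_of_eq ?_)
  rw [truncSq, ← integral_const_mul,
    ofReal_integral_eq_lintegral_ofReal (hsq.integrableOn.const_mul _)
      (ae_of_all _ fun y => by positivity)]

lemma abs_setIntegral_pow_le {ν : Measure ℝ} (hsq : Integrable (fun y : ℝ => y ^ 2) ν) {k : ℕ}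
    {ρ : ℝ} : |∫ y in {y : ℝ | |y| ≤ ρ}, y ^ (k + 2) ∂ν| ≤ ρ ^ k * truncSq ν ρ := by
  rw [truncSq, ← integral_const_mul]
  refine norm_integral_le_of_norm_le (f := fun y : ℝ => y ^ (k + 2)) (hsq.integrableOn.const_mul _)
    ((ae_restrict_iff' (measurableSet_abs_le ρ)).2 (ae_of_all _ fun y hy => ?_))
  rw [norm_pow, Real.norm_eq_abs, pow_add, sq_abs]
  exact mul_le_mul_of_nonneg_right (pow_le_pow_left₀ (abs_nonneg y) hy _) (by positivity)

lemma exists_truncSq_bounds {ν : Measure ℝ} (hsq : Integrable (fun y : ℝ => y ^ 2) ν)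
    (hfin : ∀ x, 0 < x → ν {y : ℝ | x < |y|} < ⊤)
    (htop : Tendsto (tailReal ν) (𝓝[>] 0) atTop) {α : ℝ} (hα2 : α < 2)
    (hRV : ∀ c : ℝ, 0 < c →
      Tendsto (fun x => tailReal ν (c * x) / tailReal ν x) (𝓝[>] 0) (𝓝 (c ^ (-α)))) :
    (∃ C > 0, ∀ᶠ r in 𝓝[>] 0, truncSq ν r ≤ C * (r ^ 2 * tailReal ν r)) ∧
    ∀ δ > 0, ∃ a : ℝ, 0 < a ∧ a ≤ 1 ∧
      ∀ᶠ r in 𝓝[>] 0, truncSq ν (a * r) ≤ δ * (r ^ 2 * tailReal ν r) := by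
  have hlim : ((1 / 2 : ℝ)) ^ (-α) < 4 := by
    have h4 : (4 : ℝ) = (1 / 2 : ℝ) ^ (-2 : ℝ) := by
      rw [Real.rpow_neg (by norm_num)]; norm_num
    rw [h4]
    exact Real.rpow_lt_rpow_of_exponent_gt (by norm_num) (by norm_num) (by linarith)
  obtain ⟨q, hq, hq4⟩ := exists_between hlim
  have hq0 : 0 < q := (Real.rpow_pos_of_pos (by norm_num) _).trans hq
  have hev : ∀ᶠ x in 𝓝[>] 0, tailReal ν (x / 2) ≤ q * tailReal ν x := by
    filter_upwards [(hRV (1 / 2) (by norm_num)).eventually_lt_const hq,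
      htop.eventually_gt_atTop 0] with x hx hx0
    rw [div_lt_iff₀ hx0, one_div_mul_eq_div] at hx
    exact hx.le
  obtain ⟨x₀, hx₀, hsub⟩ := mem_nhdsGT_iff_exists_Ioc_subset.1 hev
  have hq' : ∀ x, 0 < x → x ≤ x₀ → tailReal ν (x / 2) ≤ q * tailReal ν x :=
    fun x h0 h1 => hsub ⟨h0, h1⟩
  have hkar := truncSq_le_mul_tailReal hsq hfin hq0 hq4 hq'
  set C : ℝ := 4 * q / (4 - q) with hC
  have hC0 : 0 < C := div_pos (by positivity) (by linarith)
  refine ⟨⟨C, hC0, ?_⟩, fun δ hδ => ?_⟩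
  · filter_upwards [Ioc_mem_nhdsGT hx₀] with r hr using hkar r hr.1 hr.2
  have hpow : ∀ J : ℕ, ∀ x, 0 < x → x ≤ x₀ →
      tailReal ν (x / 2 ^ J) ≤ q ^ J * tailReal ν x := by
    intro J
    induction J with
    | zero => intro x _ _; simp
    | succ J ih =>
      intro x hx hxx
      have hle : x / 2 ^ J ≤ x := div_le_self hx.le (one_le_pow₀ (by norm_num))
      have h1 := hq' (x / 2 ^ J) (by positivity) (hle.trans hxx)
      have h2 := mul_le_mul_of_nonneg_left (ih x hx hxx) hq0.le
      rw [div_div, ← pow_succ] at h1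
      calc _ ≤ _ := h1
        _ ≤ _ := h2
        _ = _ := by ring
  obtain ⟨J, hJ⟩ := exists_pow_lt_of_lt_one (div_pos hδ hC0) ((div_lt_one (by norm_num)).2 hq4)
  refine ⟨1 / 2 ^ J, by positivity, ?_, ?_⟩
  · rw [div_le_one (by positivity)]; exact one_le_pow₀ (by norm_num)
  filter_upwards [Ioc_mem_nhdsGT hx₀] with r hr
  have hr0 : 0 < r := hr.1
  have hle : r / 2 ^ J ≤ r := div_le_self hr0.le (one_le_pow₀ (by norm_num))
  rw [one_div_mul_eq_div]
  have hT := tailReal_nonneg ν r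
  calc truncSq ν (r / 2 ^ J) ≤ C * ((r / 2 ^ J) ^ 2 * tailReal ν (r / 2 ^ J)) :=
        hkar _ (by positivity) (hle.trans hr.2)
    _ ≤ C * ((r / 2 ^ J) ^ 2 * (q ^ J * tailReal ν r)) := by
        gcongr; exact hpow J r hr0 hr.2
    _ = C * (q / 4) ^ J * (r ^ 2 * tailReal ν r) := by
        have h4 : ((2 : ℝ) ^ J) ^ 2 = 4 ^ J := by rw [← pow_mul, mul_comm, pow_mul]; norm_num
        rw [div_pow, div_pow, h4]; ring
    _ ≤ δ * (r ^ 2 * tailReal ν r) := by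
        refine mul_le_mul_of_nonneg_right ?_ (by positivity)
        have := (lt_div_iff₀ hC0).1 hJ
        linarith

lemma abs_setIntegral_div_sub_le {ν : Measure ℝ} {B : Set ℝ}
    (hBfin : ν B < ⊤) (hBpos : 0 < (ν B).toReal) {k : ℕ}
    (hk : Integrable (fun y : ℝ => y ^ k) ν) {r b η : ℝ} (hr : 0 < r)
    (hclose : ∀ y ∈ B, |(y / r) ^ k - b| ≤ η) :
    |(∫ y in B, y ^ k ∂ν) / (r ^ k * (ν B).toReal) - b| ≤ η := by
  have hconst : Integrable (fun _ : ℝ => b) (ν.restrict B) := integrableOn_const hBfin.ne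
  have hdiv : Integrable (fun y : ℝ => (y / r) ^ k) (ν.restrict B) := by
    simp_rw [div_pow]
    exact hk.integrableOn.div_const _
  have hbound := norm_setIntegral_le_of_norm_le_const (f := fun y : ℝ => (y / r) ^ k - b)
    hBfin hclose
  rw [integral_sub hdiv hconst, setIntegral_const, Real.norm_eq_abs, smul_eq_mul] at hbound
  simp_rw [div_pow] at hbound
  rw [integral_div] at hbound
  change |_ - (ν B).toReal * b| ≤ η * (ν B).toReal at hbound
  have hrew : (∫ y in B, y ^ k ∂ν) / (r ^ k * (ν B).toReal) - b
      = ((∫ y in B, y ^ k ∂ν) / r ^ k - (ν B).toReal * b) / (ν B).toReal := by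
    field_simp
  rw [hrew, abs_div, abs_of_pos hBpos, div_le_iff₀ hBpos]
  exact hbound

lemma exists_pow_close {N : ℕ} (v : Fin N → ℝ) {η : ℝ} (hη : 0 < η) :
    ∃ θ : ℝ, 0 < θ ∧ θ ≤ 1 ∧ ∀ k i : Fin N, ∀ z : ℝ, |z - v i| ≤ θ →
      |z ^ ((k : ℕ) + 2) - v i ^ ((k : ℕ) + 2)| ≤ η := by
  have hev : ∀ᶠ θ in 𝓝[>] (0 : ℝ), ∀ k i : Fin N, ∀ z : ℝ, |z - v i| ≤ θ →
      |z ^ ((k : ℕ) + 2) - v i ^ ((k : ℕ) + 2)| ≤ η := by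
    rw [eventually_all]
    intro k
    rw [eventually_all]
    intro i
    obtain ⟨ε, hε, hball⟩ := Metric.continuousAt_iff.1
      ((continuous_pow ((k : ℕ) + 2)).continuousAt (x := v i)) η hη
    filter_upwards [Ioo_mem_nhdsGT hε] with θ hθ z hz
    exact (hball (lt_of_le_of_lt hz hθ.2)).le
  obtain ⟨θ, hθ, hθ1⟩ := (hev.and (Ioc_mem_nhdsGT one_pos)).exists
  exact ⟨θ, hθ1.1, hθ1.2, hθ⟩

/-- At every small scale `r`, the moments of the jumps smaller than `a * r` can be compensated by
reweighting `ν` on the jumps of size between `r` and `R * r`. -/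
lemma exists_optValue_le_setLIntegral {n : ℕ} (hn : 2 ≤ n) {ν : Measure ℝ}
    (hint : ∀ k, 2 ≤ k → k ≤ n → Integrable (fun y : ℝ => y ^ k) ν)
    (hfin : ∀ x, 0 < x → ν {y : ℝ | x < |y|} < ⊤)
    (htop : Tendsto (tailReal ν) (𝓝[>] 0) atTop) {α : ℝ} (hα0 : 0 < α) (hα2 : α < 2)
    (hRV : ∀ c : ℝ, 0 < c →
      Tendsto (fun x => tailReal ν (c * x) / tailReal ν x) (𝓝[>] 0) (𝓝 (c ^ (-α))))
    {σ p : ℝ} (hσ : |σ| = 1) (hp : 0 < p)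
    (hside : ∀ c : ℝ, 0 < c →
      Tendsto (fun x => (ν {y : ℝ | c * x < σ * y}).toReal / tailReal ν x) (𝓝[>] 0)
        (𝓝 (p * c ^ (-α)))) :
    ∃ a R : ℝ, 0 < a ∧ a ≤ 1 ∧ 1 ≤ R ∧ ∀ᶠ r in 𝓝[>] 0, ∀ Λ, 2 * tailReal ν (a * r) ≤ Λ →
      optValue n ν Λ ≤ ∫⁻ y in {y : ℝ | |y| ≤ R * r}, ENNReal.ofReal (|y| ^ n) ∂ν := by
  have hsq := hint 2 le_rfl hn
  obtain ⟨N, rfl⟩ : ∃ N, n = N + 2 := ⟨n - 2, by omega⟩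
  have hσ0 : σ ≠ 0 := by rintro rfl; simp at hσ
  have hσσ : σ * σ = 1 := by rw [← abs_mul_abs_self, hσ, one_mul]
  set v : Fin N → ℝ := fun i => σ * ((i : ℝ) + 1) with hv
  have hvinj : Function.Injective v := by
    intro i j hij
    have h1 := mul_left_cancel₀ hσ0 hij
    have h2 : ((i : ℕ) : ℝ) = ((j : ℕ) : ℝ) := by linarith
    exact Fin.ext (by exact_mod_cast h2)
  have hv0 : ∀ i, v i ≠ 0 := fun i => mul_ne_zero hσ0 (by positivity)
  obtain ⟨η, hη, C, hC, hsolve⟩ :=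
    exists_bounded_solution_near _ (det_pow_add_two_ne_zero hvinj hv0)
  obtain ⟨θ, hθ0, hθ1, hθ⟩ := exists_pow_close v hη
  set B : ℝ → Fin N → Set ℝ := fun r i =>
    {y : ℝ | ((i : ℝ) + 1) * r < σ * y} \ {y : ℝ | ((i : ℝ) + 1 + θ) * r < σ * y} with hBdef
  have hσmeas : ∀ x, MeasurableSet {y : ℝ | x < σ * y} := fun x =>
    measurableSet_lt measurable_const (measurable_const.mul measurable_id)
  have hBm : ∀ r i, MeasurableSet (B r i) := fun r i => (hσmeas _).diff (hσmeas _)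
  have habs : ∀ y, |σ * y| = |y| := fun y => by rw [abs_mul, hσ, one_mul]
  have hσfin : ∀ x, 0 < x → ν {y : ℝ | x < σ * y} < ⊤ := fun x hx =>
    lt_of_le_of_lt (measure_mono fun y hy => by
      rw [mem_ofPred_eq] at hy ⊢
      exact hy.trans_le ((le_abs_self _).trans_eq (habs y))) (hfin x hx)
  have hBmem : ∀ r i y, y ∈ B r i →
      ((i : ℝ) + 1) * r < σ * y ∧ σ * y ≤ ((i : ℝ) + 1 + θ) * r := fun r i y hy =>
    ⟨hy.1, not_lt.1 hy.2⟩
  have hBfin : ∀ r, 0 < r → ∀ i, ν (B r i) < ⊤ := fun r hr i =>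
    lt_of_le_of_lt (measure_mono sdiff_subset) (hσfin _ (by positivity))
  have hBmass : ∃ κ > 0, ∀ᶠ r in 𝓝[>] 0, ∀ i, κ * tailReal ν r ≤ (ν (B r i)).toReal := by
    set l : Fin N → ℝ := fun i =>
      p * ((i : ℝ) + 1) ^ (-α) - p * ((i : ℝ) + 1 + θ) ^ (-α) with hl
    have hlpos : ∀ i, 0 < l i := by
      intro i
      rw [hl]
      have := Real.rpow_lt_rpow_of_neg (x := (i : ℝ) + 1) (y := (i : ℝ) + 1 + θ) (z := -α)
        (by positivity) (by linarith) (by linarith)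
      have := mul_lt_mul_of_pos_left this hp
      simpa using this
    have hκ : ∃ κ > 0, ∀ i, κ < l i := by
      have hev : ∀ᶠ κ in 𝓝[>] (0 : ℝ), ∀ i, κ < l i := by
        refine eventually_all.2 fun i => ?_
        filter_upwards [Ioo_mem_nhdsGT (hlpos i)] with κ hκ using hκ.2
      obtain ⟨κ, hκ, hκ0⟩ := (hev.and self_mem_nhdsWithin).exists
      exact ⟨κ, hκ0, hκ⟩
    obtain ⟨κ, hκ0, hκ⟩ := hκ
    refine ⟨κ, hκ0, eventually_all.2 fun i => ?_⟩
    have hlim := (hside ((i : ℝ) + 1) (by positivity)).sub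
      (hside ((i : ℝ) + 1 + θ) (by positivity))
    filter_upwards [hlim.eventually_const_lt (hκ i), htop.eventually_gt_atTop 0,
      self_mem_nhdsWithin] with r hr hT hr0
    have hr0 : 0 < r := hr0
    rw [← sub_div, lt_div_iff₀ hT] at hr
    refine hr.le.trans (le_of_eq ?_)
    have hsub : {y : ℝ | ((i : ℝ) + 1 + θ) * r < σ * y} ⊆ {y : ℝ | ((i : ℝ) + 1) * r < σ * y} := by
      intro y hy
      rw [mem_ofPred_eq] at hy ⊢
      nlinarith
    rw [hBdef, measure_sdiff hsub (hσmeas _).nullMeasurableSet (hσfin _ (by positivity)).ne,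
      ENNReal.toReal_sub_of_le (measure_mono hsub) (hσfin _ (by positivity)).ne]
  obtain ⟨κ, hκ0, hκ⟩ := hBmass
  set δ : ℝ := κ / (C * ((N : ℝ) + 1)) with hδ
  obtain ⟨a, ha0, ha1, ha⟩ :=
    (exists_truncSq_bounds hsq hfin htop hα2 hRV).2 δ (by positivity)
  refine ⟨a, (N : ℝ) + 1, ha0, ha1, by linarith [Nat.cast_nonneg (α := ℝ) N], ?_⟩
  filter_upwards [ha, hκ, htop.eventually_gt_atTop 0, self_mem_nhdsWithin]
    with r hra hrκ hT hr0 Λ hΛ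
  have hr0 : 0 < r := hr0
  have hνB : ∀ i, 0 < (ν (B r i)).toReal := fun i => (mul_pos hκ0 hT).trans_le (hrκ i)
  set A : Matrix (Fin N) (Fin N) ℝ := Matrix.of fun k i =>
    (∫ y in B r i, y ^ ((k : ℕ) + 2) ∂ν) / (r ^ ((k : ℕ) + 2) * (ν (B r i)).toReal) with hA
  set d : Fin N → ℝ := fun k =>
    (∫ y in {y : ℝ | |y| ≤ a * r}, y ^ ((k : ℕ) + 2) ∂ν) / (r ^ ((k : ℕ) + 2) * tailReal ν r)
    with hd
  have hdδ : ∀ k, |d k| ≤ δ := by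
    intro k
    have hden : 0 < r ^ ((k : ℕ) + 2) * tailReal ν r := by positivity
    rw [hd, abs_div, abs_of_pos hden, div_le_iff₀ hden]
    have har : 0 ≤ a * r := by positivity
    have har' : a * r ≤ r := by nlinarith
    calc _ ≤ (a * r) ^ (k : ℕ) * truncSq ν (a * r) := abs_setIntegral_pow_le hsq
      _ ≤ r ^ (k : ℕ) * (δ * (r ^ 2 * tailReal ν r)) := by
        refine mul_le_mul (pow_le_pow_left₀ har har' _) hra ?_ (by positivity)
        exact integral_nonneg fun y => sq_nonneg y
      _ = δ * (r ^ ((k : ℕ) + 2) * tailReal ν r) := by rw [pow_add]; ring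
  have hAV : ∀ k i, |A k i - (Matrix.of fun k i : Fin N => v i ^ ((k : ℕ) + 2)) k i| ≤ η := by
    intro k i
    rw [hA, Matrix.of_apply, Matrix.of_apply]
    refine abs_setIntegral_div_sub_le (hBfin r hr0 i) (hνB i)
      (hint _ (by omega) (by omega)) hr0 fun y hy => hθ k i _ ?_
    obtain ⟨h1, h2⟩ := hBmem r i y hy
    have hrew : y / r - v i = σ * ((σ * y - ((i : ℝ) + 1) * r) / r) := by
      rw [hv]; field_simp; linear_combination (-y) * hσσ
    rw [hrew, habs, abs_of_nonneg (div_nonneg (by linarith) hr0.le), div_le_iff₀ hr0]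
    linarith
  obtain ⟨c, hAc, hc⟩ := hsolve A hAV d δ hdδ
  set w : Fin N → ℝ := fun i => c i * tailReal ν r / (ν (B r i)).toReal with hw
  refine optValue_le_of_reweighting hn hint hfin (hBm r) (w := w) ?_ (ρ := a * r)
    (by positivity) ?_ ?_ ?_ ?_ hΛ
  · have hwi : ∀ i, |w i| ≤ 1 / ((N : ℝ) + 1) := by
      intro i
      have hci := hc i
      have hCδ : C * δ = κ / ((N : ℝ) + 1) := by rw [hδ]; field_simp
      rw [hCδ] at hci
      rw [hw, abs_div, abs_mul, abs_of_pos hT, abs_of_pos (hνB i), div_le_iff₀ (hνB i)]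
      calc |c i| * tailReal ν r ≤ κ / ((N : ℝ) + 1) * tailReal ν r := by gcongr
        _ = 1 / ((N : ℝ) + 1) * (κ * tailReal ν r) := by ring
        _ ≤ _ := by gcongr; exact hrκ i
    refine (Finset.sum_le_sum fun i _ => hwi i).trans ?_
    rw [Finset.sum_const, Finset.card_univ, Fintype.card_fin, nsmul_eq_mul, mul_one_div,
      div_le_one (by positivity)]
    linarith
  · nlinarith [Nat.cast_nonneg (α := ℝ) N]
  · intro i y hy
    have h1 := (hBmem r i y hy).1
    have h2 := (le_abs_self (σ * y)).trans_eq (habs y)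
    have h3 : (0 : ℝ) ≤ (i : ℝ) := Nat.cast_nonneg _
    nlinarith
  · intro i y hy
    obtain ⟨h1, h2⟩ := hBmem r i y hy
    have h3 : (0 : ℝ) ≤ (i : ℝ) := Nat.cast_nonneg _
    have h4 : (i : ℝ) + 1 ≤ N := by exact_mod_cast i.2
    rw [← habs y, abs_of_nonneg (le_trans (by positivity) h1.le)]
    nlinarith
  · intro k hk2 hkN
    obtain ⟨j, rfl⟩ : ∃ j, k = j + 2 := ⟨k - 2, by omega⟩
    have hj := congrFun hAc ⟨j, by omega⟩
    simp only [Matrix.mulVec, dotProduct, hA, hd, Matrix.of_apply] at hj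
    rw [eq_div_iff (by positivity), Finset.sum_mul] at hj
    rw [← hj]
    refine Finset.sum_congr rfl fun i _ => ?_
    have := (hνB i).ne'
    rw [hw]
    field_simp

lemma exists_optValue_le {n : ℕ} (hn : 2 ≤ n) {ν : Measure ℝ}
    (hint : ∀ k, 2 ≤ k → k ≤ n → Integrable (fun y : ℝ => y ^ k) ν)
    (hfin : ∀ x, 0 < x → ν {y : ℝ | x < |y|} < ⊤)
    (htop : Tendsto (tailReal ν) (𝓝[>] 0) atTop) {α : ℝ} (hα0 : 0 < α) (hα2 : α < 2)
    (hRV : ∀ c : ℝ, 0 < c →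
      Tendsto (fun x => tailReal ν (c * x) / tailReal ν x) (𝓝[>] 0) (𝓝 (c ^ (-α))))
    {σ p : ℝ} (hσ : |σ| = 1) (hp : 0 < p)
    (hside : ∀ c : ℝ, 0 < c →
      Tendsto (fun x => (ν {y : ℝ | c * x < σ * y}).toReal / tailReal ν x) (𝓝[>] 0)
        (𝓝 (p * c ^ (-α)))) :
    ∃ C > 0, ∀ᶠ Λ in atTop, optValue n ν Λ ≤ ENNReal.ofReal (C * (Λ * epsOf ν Λ ^ n)) := by
  have hsq := hint 2 le_rfl hn
  obtain ⟨a, R, ha0, ha1, hR1, hopt⟩ :=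
    exists_optValue_le_setLIntegral hn hint hfin htop hα0 hα2 hRV hσ hp hside
  obtain ⟨K, hK0, hK⟩ := (exists_truncSq_bounds hsq hfin htop hα2 hRV).1
  set M : ℝ := 4 ^ (1 / α) with hM
  have hM0 : 0 < M := Real.rpow_pos_of_pos (by norm_num) _
  have hMα : M ^ (-α) < 1 / 2 := by
    rw [hM, ← Real.rpow_mul (by norm_num)]
    have : 1 / α * -α = -1 := by field_simp
    rw [this, Real.rpow_neg_one]
    norm_num
  have hR0 : 0 < R := by linarith
  have hε := tendsto_epsOf hfin htop
  have hscale : ∀ β : ℝ, 0 < β → Tendsto (fun Λ => β * epsOf ν Λ) atTop (𝓝[>] 0) := by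
    intro β hβ
    rw [tendsto_nhdsWithin_iff] at hε ⊢
    refine ⟨by simpa using hε.1.const_mul β, ?_⟩
    filter_upwards [hε.2] with Λ hΛ using mul_pos hβ hΛ
  have hb0 : 0 < 2 * M / a := by positivity
  have hRb0 : 0 < R * (2 * M / a) := by positivity
  refine ⟨K * (R * (2 * M / a)) ^ n, by positivity, ?_⟩
  filter_upwards [hε.eventually self_mem_nhdsWithin, eventually_gt_atTop (tailReal ν 1),
    (hscale _ hb0).eventually hopt, (hscale _ hRb0).eventually hK,
    (hscale 2 two_pos).eventually ((hRV M hM0).eventually_lt_const hMα),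
    (hscale 2 two_pos).eventually (htop.eventually_gt_atTop 0)] with Λ hε0 hΛ1 hoptΛ hKΛ hTM hT0
  have hε0 : 0 < epsOf ν Λ := hε0
  rw [div_lt_iff₀ hT0] at hTM
  have hTΛ : tailReal ν (2 * epsOf ν Λ) < Λ := tailReal_lt_of_epsOf_lt hfin hΛ1 (by linarith)
  have har : a * (2 * M / a * epsOf ν Λ) = M * (2 * epsOf ν Λ) := by field_simp
  have hmass : 2 * tailReal ν (a * (2 * M / a * epsOf ν Λ)) ≤ Λ := by
    rw [har]; linarith
  refine (hoptΛ Λ hmass).trans ((setLIntegral_abs_pow_le hn hsq (by positivity)).trans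
    (ENNReal.ofReal_le_ofReal ?_))
  rw [← mul_assoc R]
  set z : ℝ := R * (2 * M / a) * epsOf ν Λ with hz
  have hz0 : 0 < z := by positivity
  have hTz : tailReal ν z ≤ Λ := by
    have hle : a * (2 * M / a * epsOf ν Λ) ≤ z := by
      rw [hz, mul_assoc]
      exact mul_le_mul_of_nonneg_right (ha1.trans hR1) (by positivity)
    have h1 := tailReal_anti hfin (by positivity) hle
    have h2 := tailReal_nonneg ν (a * (2 * M / a * epsOf ν Λ))
    linarith
  calc z ^ (n - 2) * truncSq ν z ≤ z ^ (n - 2) * (K * (z ^ 2 * tailReal ν z)) := by gcongr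
    _ = K * z ^ n * tailReal ν z := by
      rw [← Nat.sub_add_cancel hn, pow_add, Nat.add_sub_cancel]; ring
    _ ≤ K * z ^ n * Λ := by gcongr
    _ = K * (R * (2 * M / a)) ^ n * (Λ * epsOf ν Λ ^ n) := by rw [hz, mul_pow]; ring

/-- A finite measure of mass `Λ` misses at least half of the mass `2Λ` of the jumps larger than
`r`. -/
lemma le_optValue_of_two_mul_le_tailReal {n : ℕ} {ν : Measure ℝ} {Λ r : ℝ} (hr : 0 < r)
    (hΛ0 : 0 ≤ Λ) (hfin : ν {y : ℝ | r < |y|} < ⊤) (hΛ : 2 * Λ ≤ tailReal ν r) :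
    ENNReal.ofReal (Λ * r ^ n) ≤ optValue n ν Λ := by
  refine le_iInf₂ fun νb hcon => ?_
  obtain ⟨hfinb, hmass, -⟩ := hcon
  have : IsFiniteMeasure (ν ⊓ νb) := isFiniteMeasure_of_le νb inf_le_right
  set S : Set ℝ := {y : ℝ | r < |y|} with hS
  have hsub : ENNReal.ofReal Λ ≤ tvDist ν νb S := by
    have h1 : ENNReal.ofReal Λ + ENNReal.ofReal Λ ≤ ν S := by
      rw [← ENNReal.ofReal_add hΛ0 hΛ0, ← two_mul]
      exact (ENNReal.ofReal_le_iff_le_toReal hfin.ne).2 hΛ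
    have h2 : ν S ≤ (ν - ν ⊓ νb) S + ENNReal.ofReal Λ := by
      conv_lhs => rw [← Measure.sub_add_cancel_of_le (inf_le_left : ν ⊓ νb ≤ ν)]
      rw [Measure.add_apply]
      gcongr
      calc (ν ⊓ νb) S ≤ νb S := (inf_le_right : ν ⊓ νb ≤ νb) S
        _ ≤ νb univ := measure_mono (subset_univ _)
        _ = _ := hmass
    refine ((ENNReal.add_le_add_iff_right ENNReal.ofReal_ne_top).1 (h1.trans h2)).trans ?_
    rw [tvDist, Measure.add_apply]
    exact le_self_add
  calc ENNReal.ofReal (Λ * r ^ n) = ENNReal.ofReal (r ^ n) * ENNReal.ofReal Λ := by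
        rw [mul_comm, ENNReal.ofReal_mul (by positivity)]
    _ ≤ ENNReal.ofReal (r ^ n) * tvDist ν νb S := by gcongr
    _ = ∫⁻ _ in S, ENNReal.ofReal (r ^ n) ∂(tvDist ν νb) := (setLIntegral_const _ _).symm
    _ ≤ ∫⁻ y in S, ENNReal.ofReal (|y| ^ n) ∂(tvDist ν νb) := by
        refine setLIntegral_mono' (measurableSet_lt_abs r) fun y hy => ?_
        exact ENNReal.ofReal_le_ofReal (pow_le_pow_left₀ hr.le (le_of_lt hy) n)
    _ ≤ Jfun n ν νb := setLIntegral_le_lintegral _ _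

lemma exists_le_optValue {n : ℕ} {ν : Measure ℝ} (hfin : ∀ x, 0 < x → ν {y : ℝ | x < |y|} < ⊤)
    (htop : Tendsto (tailReal ν) (𝓝[>] 0) atTop) {L : ℝ} (hL : 0 < L)
    (hratio : Tendsto (fun Λ => epsOf ν (2 * Λ) / epsOf ν Λ) atTop (𝓝 L)) :
    ∃ C > 0, ∀ᶠ Λ in atTop, ENNReal.ofReal (C * (Λ * epsOf ν Λ ^ n)) ≤ optValue n ν Λ := by
  have hε := tendsto_epsOf hfin htop
  refine ⟨(L / 4) ^ n, by positivity, ?_⟩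
  filter_upwards [hε.eventually self_mem_nhdsWithin, eventually_ge_atTop 0,
    hratio.eventually_const_lt (half_lt_self hL)] with Λ hε0 hΛ0 hlt
  have hε0 : 0 < epsOf ν Λ := hε0
  rw [lt_div_iff₀ hε0] at hlt
  have hr : 0 < L / 4 * epsOf ν Λ := by positivity
  have hΛ : 2 * Λ ≤ tailReal ν (L / 4 * epsOf ν Λ) := by
    by_contra hcon
    have := epsOf_le_of_tailReal_lt hfin hr (not_le.1 hcon)
    nlinarith
  have hmain := le_optValue_of_two_mul_le_tailReal (n := n) hr hΛ0 (hfin _ hr) hΛ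
  rwa [mul_pow, ← mul_left_comm] at hmain

lemma tendsto_ratio_of_tendsto_div {H T g : ℝ → ℝ} {b t α : ℝ} (ht : t ≠ 0)
    (hgpos : ∀ x, 0 < x → 0 < g x)
    (hgRV : ∀ c : ℝ, 0 < c → Tendsto (fun x => g (c * x) / g x) (𝓝[>] 0) (𝓝 (c ^ (-α))))
    (hH : Tendsto (fun x => H x / g x) (𝓝[>] 0) (𝓝 b))
    (hT : Tendsto (fun x => T x / g x) (𝓝[>] 0) (𝓝 t)) {c : ℝ} (hc : 0 < c) :
    Tendsto (fun x => H (c * x) / T x) (𝓝[>] 0) (𝓝 (b / t * c ^ (-α))) := by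
  have hscale : Tendsto (fun x : ℝ => c * x) (𝓝[>] 0) (𝓝[>] 0) := by
    rw [tendsto_nhdsWithin_iff]
    refine ⟨?_, ?_⟩
    · have : Tendsto (fun x : ℝ => c * x) (𝓝 0) (𝓝 (c * 0)) := tendsto_id.const_mul c
      rw [mul_zero] at this
      exact this.mono_left nhdsWithin_le_nhds
    · filter_upwards [self_mem_nhdsWithin] with x hx using mul_pos hc hx
  have hlim := ((hH.comp hscale).mul (hgRV c hc)).div hT ht
  have heq : b * c ^ (-α) / t = b / t * c ^ (-α) := by ring
  rw [heq] at hlim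
  refine hlim.congr' ?_
  filter_upwards [self_mem_nhdsWithin] with x hx
  have h1 := (hgpos x hx).ne'
  have h2 := (hgpos (c * x) (mul_pos hc hx)).ne'
  simp only [Pi.div_apply, Function.comp_apply]
  rw [div_mul_div_cancel₀ h2, div_div_div_cancel_right₀ h1]

lemma tailReal_eq_add {ν : Measure ℝ} {x : ℝ} (hx : 0 < x) (hfin : ν {y : ℝ | x < |y|} < ⊤) :
    tailReal ν x = (ν (Ioi x)).toReal + (ν (Iio (-x))).toReal := by
  have hunion : {y : ℝ | x < |y|} = Ioi x ∪ Iio (-x) := by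
    ext y
    simp only [mem_ofPred_eq, mem_union, mem_Ioi, mem_Iio, lt_abs]
    constructor <;> rintro (h | h)
    · exact Or.inl h
    · exact Or.inr (by linarith)
    · exact Or.inl h
    · exact Or.inr (by linarith)
  have hdisj : Disjoint (Ioi x) (Iio (-x)) := by
    rw [Set.disjoint_left]
    intro y h1 h2
    rw [mem_Ioi] at h1
    rw [mem_Iio] at h2
    linarith
  rw [hunion] at hfin
  rw [tailReal, hunion, measure_union hdisj measurableSet_Iio, ENNReal.toReal_add]
  · exact ((measure_mono subset_union_left).trans_lt hfin).ne
  · exact ((measure_mono subset_union_right).trans_lt hfin).ne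

/-- Theorem `TheoMainRegVar`: for `n` even and a Lévy measure `ν` satisfying the regular
variation assumption `(R_α)`, the function `f(Λ) = Λ ε(Λ)^n` is regularly varying at infinity
with index `1 - n/α`, and `c̲ f(Λ) ≤ E_n(Λ) ≤ c̄ f(Λ)` for all `Λ` large enough. -/
theorem stmt_12 (n : ℕ) (hn : 2 ≤ n) (hneven : Even n) (ν : Measure ℝ)
    (hν0 : ν {0} = 0) (hνinf : ν Set.univ = ⊤)
    (hmom : ∀ k, 2 ≤ k → k ≤ n → (∫⁻ y, ENNReal.ofReal (|y| ^ k) ∂ν) < ⊤)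
    (α : ℝ) (hα0 : 0 < α) (hα2 : α < 2)
    (cp cm : ℝ) (hcp : 0 ≤ cp) (hcm : 0 ≤ cm) (hcpm : 0 < cp + cm)
    (g : ℝ → ℝ) (hgpos : ∀ x, 0 < x → 0 < g x)
    (hgRV : ∀ c : ℝ, 0 < c → Filter.Tendsto (fun x => g (c * x) / g x)
      (nhdsWithin 0 (Set.Ioi 0)) (nhds (c ^ (-α))))
    (htailp : Filter.Tendsto (fun x => (ν (Set.Ioi x)).toReal / g x)
      (nhdsWithin 0 (Set.Ioi 0)) (nhds cp))
    (htailm : Filter.Tendsto (fun x => (ν (Set.Iio (-x))).toReal / g x)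
      (nhdsWithin 0 (Set.Ioi 0)) (nhds cm)) :
    (∀ c : ℝ, 0 < c →
      Filter.Tendsto (fun Λ => (c * Λ * epsOf ν (c * Λ) ^ n) / (Λ * epsOf ν Λ ^ n))
        Filter.atTop (nhds (c ^ (1 - (n : ℝ) / α)))) ∧
    ∃ clo chi Λ₀ : ℝ, 0 < clo ∧ clo ≤ chi ∧ ∀ Λ, Λ₀ ≤ Λ →
      ENNReal.ofReal (clo * (Λ * epsOf ν Λ ^ n)) ≤ optValue n ν Λ ∧
      optValue n ν Λ ≤ ENNReal.ofReal (chi * (Λ * epsOf ν Λ ^ n)) := by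
  have hfin : ∀ x, 0 < x → ν {y : ℝ | x < |y|} < ⊤ :=
    fun x hx => measure_lt_abs_lt_top (hmom 2 le_rfl hn) hx
  have hint : ∀ k, 2 ≤ k → k ≤ n → Integrable (fun y : ℝ => y ^ k) ν :=
    fun k h2 hk => integrable_pow_of_lintegral_lt_top (hmom k h2 hk)
  have htop := tendsto_tailReal_atTop hν0 hνinf hfin
  have htail : Tendsto (fun x => tailReal ν x / g x) (𝓝[>] 0) (𝓝 (cp + cm)) := by
    refine (htailp.add htailm).congr' ?_
    filter_upwards [self_mem_nhdsWithin] with x hx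
    rw [tailReal_eq_add hx (hfin x hx), add_div]
  have hRV : ∀ c : ℝ, 0 < c →
      Tendsto (fun x => tailReal ν (c * x) / tailReal ν x) (𝓝[>] 0) (𝓝 (c ^ (-α))) := by
    intro c hc
    have := tendsto_ratio_of_tendsto_div hcpm.ne' hgpos hgRV htail htail hc
    rwa [div_self hcpm.ne', one_mul] at this
  have hratio : ∀ c : ℝ, 0 < c →
      Tendsto (fun Λ => epsOf ν (c * Λ) / epsOf ν Λ) atTop (𝓝 (c ^ (-(1 / α)))) := by
    intro c hc
    refine tendsto_inverse_ratio hα0 hRV (htop.eventually_gt_atTop 0) (tendsto_epsOf hfin htop)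
      ?_ ?_ hc
    · filter_upwards [eventually_gt_atTop (tailReal ν 1)] with Λ hΛ x hx
      exact tailReal_lt_of_epsOf_lt hfin hΛ hx
    · exact Eventually.of_forall fun Λ x hx0 hx => epsOf_le_of_tailReal_lt hfin hx0 hx
  refine ⟨fun c hc => ?_, ?_⟩
  · have hlim := ((hratio c hc).pow n).const_mul c
    have hexp : c * (c ^ (-(1 / α))) ^ n = c ^ (1 - (n : ℝ) / α) := by
      rw [← Real.rpow_natCast, ← Real.rpow_mul hc.le, sub_eq_add_neg, Real.rpow_add hc,
        Real.rpow_one]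
      congr 2
      ring
    rw [hexp] at hlim
    refine hlim.congr' ?_
    filter_upwards [eventually_ne_atTop 0] with Λ hΛ
    rw [div_pow, mul_comm c Λ, mul_assoc, mul_div_mul_left _ _ hΛ, mul_div_assoc]
  have hupper : ∃ C > 0, ∀ᶠ Λ in atTop,
      optValue n ν Λ ≤ ENNReal.ofReal (C * (Λ * epsOf ν Λ ^ n)) := by
    rcases hcp.eq_or_lt with hcp0 | hcp0
    · have hcm0 : 0 < cm := by linarith
      refine exists_optValue_le hn hint hfin htop hα0 hα2 hRV (σ := -1) (by simp)
        (div_pos hcm0 hcpm) fun c hc => ?_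
      have hset : ∀ x : ℝ, {y : ℝ | c * x < -1 * y} = Iio (-(c * x)) := fun x => by
        ext y; simp [lt_neg]
      simp_rw [hset]
      exact tendsto_ratio_of_tendsto_div hcpm.ne' hgpos hgRV htailm htail hc
    · refine exists_optValue_le hn hint hfin htop hα0 hα2 hRV (σ := 1) (by simp)
        (div_pos hcp0 hcpm) fun c hc => ?_
      have hset : ∀ x : ℝ, {y : ℝ | c * x < 1 * y} = Ioi (c * x) := fun x => by
        ext y; simp
      simp_rw [hset]
      exact tendsto_ratio_of_tendsto_div hcpm.ne' hgpos hgRV htailp htail hc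
  obtain ⟨chi, -, hupper⟩ := hupper
  obtain ⟨clo, hclo, hlower⟩ := exists_le_optValue (n := n) hfin htop
    (Real.rpow_pos_of_pos two_pos _) (hratio 2 two_pos)
  obtain ⟨Λ₀, hΛ₀⟩ := eventually_atTop.1 ((hlower.and hupper).and (eventually_ge_atTop 0))
  refine ⟨clo, max clo chi, Λ₀, hclo, le_max_left _ _, fun Λ hΛ => ?_⟩
  obtain ⟨⟨hlo, hhi⟩, hΛ0⟩ := hΛ₀ Λ hΛ
  refine ⟨hlo, hhi.trans (ENNReal.ofReal_le_ofReal ?_)⟩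
  have hε0 : 0 ≤ epsOf ν Λ := Real.sInf_nonneg fun e he => he.1.le
  exact mul_le_mul_of_nonneg_right (le_max_right _ _) (by positivity)
end
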